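/- arXiv:2408.09294 — 10 statements merged into one kernel-verified Lean document; each statement's English description precedes it below -/
import Mathlib

section
/- Fix actions a and b with neither weakly dominating the other. A continuous action â is b-superior to a if and only if (i) â(θ) > b(θ) for every θ ∈ 𝒜, and (ii) â weakly dominates a mixture of a and b, i.e. there exists λ ∈ [0,1] such that â(θ) ≥ λ·a(θ) + (1−λ)·b(θ) for every θ ∈ Θ. -/
open MeasureTheory

/-- Action `ahat` is b-superior to `a`: for every strictly increasing, concave,
continuous utility and every Borel probability measure (belief), preferring `a`
to `b` (weakly/strictly) implies preferring `ahat` to `b` (weakly/strictly). -/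
def BSuperior {Θ : Type*} [TopologicalSpace Θ] [MeasurableSpace Θ]
    (a b ahat : C(Θ, ℝ)) : Prop :=
  ∀ u : ℝ → ℝ, StrictMono u → ConcaveOn ℝ Set.univ u → Continuous u →
    ∀ μ : Measure Θ, IsProbabilityMeasure μ →
      ((∫ θ, u (a θ) ∂μ) ≥ (∫ θ, u (b θ) ∂μ) →
        (∫ θ, u (ahat θ) ∂μ) ≥ (∫ θ, u (b θ) ∂μ)) ∧
      ((∫ θ, u (a θ) ∂μ) > (∫ θ, u (b θ) ∂μ) →
        (∫ θ, u (ahat θ) ∂μ) > (∫ θ, u (b θ) ∂μ))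

/-- A continuous real function of a continuous map on a compact space is integrable. -/
lemma integrable_comp_continuousMap {Θ : Type*} [TopologicalSpace Θ] [CompactSpace Θ]
    [MeasurableSpace Θ] [BorelSpace Θ] {u : ℝ → ℝ} (hu : Continuous u) (f : C(Θ, ℝ))
    (μ : Measure Θ) [IsFiniteMeasure μ] : Integrable (fun θ => u (f θ)) μ :=
  (hu.comp f.continuous).integrable_of_hasCompactSupport
    (HasCompactSupport.of_compactSpace _)

/-- The integral against the two-point distribution with weight `p` at `s` and `1 - p` at `t`. -/
lemma integral_two_point {Θ : Type*} [MeasurableSpace Θ] [MeasurableSingletonClass Θ]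
    {p : ℝ} (h0 : 0 ≤ p) (h1 : p ≤ 1) (s t : Θ) (f : Θ → ℝ) :
    ∫ θ, f θ ∂(ENNReal.ofReal p • Measure.dirac s + ENNReal.ofReal (1 - p) • Measure.dirac t)
      = p * f s + (1 - p) * f t := by
  rw [integral_add_measure
      ((integrable_dirac (by simp)).smul_measure ENNReal.ofReal_ne_top)
      ((integrable_dirac (by simp)).smul_measure ENNReal.ofReal_ne_top),
    integral_smul_measure, integral_smul_measure, integral_dirac, integral_dirac,
    ENNReal.toReal_ofReal h0, ENNReal.toReal_ofReal (by linarith), smul_eq_mul, smul_eq_mul]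

lemma isProbabilityMeasure_two_point {Θ : Type*} [MeasurableSpace Θ]
    {p : ℝ} (h0 : 0 ≤ p) (h1 : p ≤ 1) (s t : Θ) :
    IsProbabilityMeasure
      (ENNReal.ofReal p • Measure.dirac s + ENNReal.ofReal (1 - p) • Measure.dirac t) := by
  constructor
  simp [← ENNReal.ofReal_add h0 (sub_nonneg.2 h1)]

/-- The utility with slope `1` above `k` and slope `1 + M` below `k`. -/
def kinkedUtility (M k x : ℝ) : ℝ := x + M * min x k

lemma strictMono_kinkedUtility {M : ℝ} (hM : 0 ≤ M) (k : ℝ) :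
    StrictMono (kinkedUtility M k) := fun _ _ hxy =>
  add_lt_add_of_lt_of_le hxy (mul_le_mul_of_nonneg_left (min_le_min_right k hxy.le) hM)

lemma continuous_kinkedUtility (M k : ℝ) : Continuous (kinkedUtility M k) := by
  unfold kinkedUtility
  fun_prop

lemma concaveOn_kinkedUtility {M : ℝ} (hM : 0 ≤ M) (k : ℝ) :
    ConcaveOn ℝ Set.univ (kinkedUtility M k) :=
  (concaveOn_id convex_univ).add
    (((concaveOn_id convex_univ).inf (concaveOn_const k convex_univ)).smul hM)

/-- Increments of a concave increasing function to the right of a point `y` are bounded by a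
multiple of a given increment that does not depend on the function. -/
lemma ConcaveOn.sub_le_mul_sub {u : ℝ → ℝ} (hu : ConcaveOn ℝ Set.univ u) (hmono : Monotone u)
    {x y z : ℝ} (hyx : y < x) (hyz : y < z) :
    u z - u y ≤ (1 + (z - y) / (x - y)) * (u x - u y) := by
  have hx : 0 < x - y := sub_pos.2 hyx
  have hz : 0 < z - y := sub_pos.2 hyz
  have hux : 0 ≤ u x - u y := sub_nonneg.2 (hmono hyx.le)
  have hr : 0 ≤ (z - y) / (x - y) * (u x - u y) := mul_nonneg (by positivity) hux
  rcases le_or_gt z x with hzx | hzx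
  · have := hmono hzx
    linarith
  · have h := hu.slope_anti_adjacent (Set.mem_univ y) (Set.mem_univ z) hyx hzx
    have hd : 0 < z - x := sub_pos.2 hzx
    have hle : u z - u x ≤ (z - x) / (x - y) * (u x - u y) := by
      rw [div_le_div_iff₀ hd hx] at h
      rw [div_mul_eq_mul_div, le_div_iff₀ hx]
      linarith
    have : (z - x) / (x - y) * (u x - u y) ≤ (z - y) / (x - y) * (u x - u y) := by
      gcongr
    linarith

namespace BSuperior

variable {Θ : Type*} [TopologicalSpace Θ] [MeasurableSpace Θ] [MeasurableSingletonClass Θ]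
  {a b ahat : C(Θ, ℝ)}

lemma le_of_le (h : BSuperior a b ahat) {θ : Θ} (hθ : b θ ≤ a θ) : b θ ≤ ahat θ := by
  simpa [hθ] using (h id strictMono_id (concaveOn_id convex_univ) continuous_id
    (Measure.dirac θ) inferInstance).1

lemma lt_of_lt (h : BSuperior a b ahat) {θ : Θ} (hθ : b θ < a θ) : b θ < ahat θ := by
  simpa [hθ] using (h id strictMono_id (concaveOn_id convex_univ) continuous_id
    (Measure.dirac θ) inferInstance).2

/-- The restriction that two-point beliefs making the agent indifferent impose. -/
lemma two_point (h : BSuperior a b ahat) {u : ℝ → ℝ} (hmono : StrictMono u)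
    (hconc : ConcaveOn ℝ Set.univ u) (hcont : Continuous u) {s t : Θ}
    (hs : b s < a s) (ht : a t < b t) :
    (u (b t) - u (ahat t)) * (u (a s) - u (b s)) ≤
      (u (ahat s) - u (b s)) * (u (b t) - u (a t)) := by
  have hs' : 0 < u (a s) - u (b s) := sub_pos.2 (hmono hs)
  have ht' : 0 < u (b t) - u (a t) := sub_pos.2 (hmono ht)
  set d := u (a s) - u (b s) with hd
  set e := u (b t) - u (a t) with he
  have h0 : 0 ≤ e / (d + e) := by positivity
  have h1 : e / (d + e) ≤ 1 := by
    rw [div_le_one (by positivity)]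
    linarith
  have key := (h u hmono hconc hcont _ (isProbabilityMeasure_two_point h0 h1 s t)).1
  rw [integral_two_point h0 h1 s t fun θ => u (a θ),
    integral_two_point h0 h1 s t fun θ => u (b θ),
    integral_two_point h0 h1 s t fun θ => u (ahat θ)] at key
  have hq : 1 - e / (d + e) = d / (d + e) := by
    field_simp
    ring
  have hmix (x y : ℝ) : e / (d + e) * x + (1 - e / (d + e)) * y = (e * x + d * y) / (d + e) := by
    rw [hq]
    ring
  simp only [hmix, ge_iff_le, div_le_div_iff_of_pos_right (add_pos hs' ht')] at key
  have := key (by rw [hd, he]; linarith)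
  linarith

lemma le_of_lt (h : BSuperior a b ahat) {s t : Θ} (hs : b s < a s) (ht : a t < b t) :
    a t ≤ ahat t := by
  by_contra! hlt
  set K := 1 + (ahat s - b s) / (a s - b s)
  have hbs := h.lt_of_lt hs
  have hK : 0 ≤ K := add_nonneg zero_le_one (div_nonneg (by linarith) (by linarith))
  have hgap : 0 < a t - ahat t := sub_pos.2 hlt
  set M := K * (b t - a t) / (a t - ahat t)
  have hM : 0 ≤ M := div_nonneg (mul_nonneg hK (by linarith)) hgap.le
  have hmono := strictMono_kinkedUtility hM (a t)
  have hconc := concaveOn_kinkedUtility hM (a t)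
  have h2 := h.two_point hmono hconc (continuous_kinkedUtility M (a t)) hs ht
  have h3 := hconc.sub_le_mul_sub hmono.monotone hs hbs
  have hpos := sub_pos.2 (hmono hs)
  have h4 : kinkedUtility M (a t) (b t) - kinkedUtility M (a t) (a t) = b t - a t := by
    simp [kinkedUtility, min_eq_right ht.le]
  have h5 : kinkedUtility M (a t) (b t) - kinkedUtility M (a t) (ahat t)
      = b t - ahat t + K * (b t - a t) := by
    have : M * (a t - ahat t) = K * (b t - a t) := div_mul_cancel₀ _ hgap.ne'
    simp only [kinkedUtility, min_eq_right ht.le, min_eq_left hlt.le]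
    linarith
  rw [h4, h5] at h2
  have h6 := mul_le_mul_of_nonneg_right h3 (sub_nonneg.2 ht.le)
  nlinarith [mul_pos (show 0 < b t - ahat t by linarith) hpos]

lemma exists_mixture_le (h : BSuperior a b ahat) (hA : ∃ θ, a θ > b θ) :
    ∃ l : ℝ, l ∈ Set.Icc (0 : ℝ) 1 ∧ ∀ θ, ahat θ ≥ l * a θ + (1 - l) * b θ := by
  obtain ⟨s₀, hs₀⟩ := hA
  let S : Set ℝ := insert 0 ((fun t => (b t - ahat t) / (b t - a t)) '' {t | a t < b t})
  have hne : S.Nonempty := Set.insert_nonempty _ _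
  have h1 : ∀ x ∈ S, x ≤ 1 := by
    rintro _ (rfl | ⟨t, ht, rfl⟩)
    · exact zero_le_one
    · rw [div_le_one (sub_pos.2 ht)]
      linarith [h.le_of_lt hs₀ ht]
  have hbdd : BddAbove S := ⟨1, h1⟩
  refine ⟨sSup S, ⟨le_csSup hbdd (Set.mem_insert _ _), csSup_le hne h1⟩, fun θ => ?_⟩
  rcases lt_trichotomy (a θ) (b θ) with hθ | hθ | hθ
  · have hle := le_csSup hbdd (Set.mem_insert_of_mem _ ⟨θ, hθ, rfl⟩)
    rw [div_le_iff₀ (sub_pos.2 hθ)] at hle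
    linarith
  · have := h.le_of_le hθ.ge
    rw [hθ]
    linarith
  · have hle : sSup S ≤ (ahat θ - b θ) / (a θ - b θ) := by
      refine csSup_le hne ?_
      rintro _ (rfl | ⟨t, ht, rfl⟩)
      · exact div_nonneg (sub_nonneg.2 (h.lt_of_lt hθ).le) (sub_nonneg.2 hθ.le)
      · rw [div_le_div_iff₀ (sub_pos.2 ht) (sub_pos.2 hθ)]
        exact h.two_point strictMono_id (concaveOn_id convex_univ) continuous_id hθ ht
    rw [le_div_iff₀ (sub_pos.2 hθ)] at hle
    linarith

end BSuperior

lemma bSuperior_of_mixture_le {Θ : Type*} [TopologicalSpace Θ] [CompactSpace Θ]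
    [MeasurableSpace Θ] [BorelSpace Θ] {a b ahat : C(Θ, ℝ)}
    (hpos : ∀ θ, a θ > b θ → ahat θ > b θ) {l : ℝ} (hl : l ∈ Set.Icc (0 : ℝ) 1)
    (hmix : ∀ θ, ahat θ ≥ l * a θ + (1 - l) * b θ) : BSuperior a b ahat := by
  intro u hmono hconc hcont μ _
  have ia := integrable_comp_continuousMap hcont a μ
  have ib := integrable_comp_continuousMap hcont b μ
  have ih := integrable_comp_continuousMap hcont ahat μ
  have hle : l * ∫ θ, u (a θ) ∂μ + (1 - l) * ∫ θ, u (b θ) ∂μ ≤ ∫ θ, u (ahat θ) ∂μ := by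
    rw [← integral_const_mul, ← integral_const_mul,
      ← integral_add (ia.const_mul _) (ib.const_mul _)]
    refine integral_mono ((ia.const_mul _).add (ib.const_mul _)) ih fun θ => ?_
    exact (hconc.2 (Set.mem_univ (a θ)) (Set.mem_univ (b θ)) hl.1 (sub_nonneg.2 hl.2)
      (by ring)).trans (hmono.monotone (hmix θ))
  refine ⟨fun hab => by nlinarith [hl.1], fun hab => ?_⟩
  rcases hl.1.eq_or_lt with rfl | hl0
  · have hdom : ∀ θ, b θ ≤ ahat θ := fun θ => by simpa using hmix θ
    refine lt_of_le_of_ne (integral_mono ib ih fun θ => hmono.monotone (hdom θ)) fun heq => ?_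
    have hae := (integral_eq_iff_of_ae_le ib ih
      (ae_of_all _ fun θ => hmono.monotone (hdom θ))).1 heq
    refine hab.not_ge (integral_mono_ae ia ib ?_)
    filter_upwards [hae] with θ hθ
    refine hmono.monotone (le_of_not_gt fun hlt => ?_)
    exact (hpos θ hlt).ne (hmono.injective hθ)
  · nlinarith

/-- Theorem 1: `ahat` is b-superior to `a` iff `ahat θ > b θ` on 𝒜 and `ahat`
weakly dominates a mixture of `a` and `b`. -/
theorem bSuperior_iff {Θ : Type*} [TopologicalSpace Θ] [CompactSpace Θ]
    [TopologicalSpace.MetrizableSpace Θ] [MeasurableSpace Θ] [BorelSpace Θ]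
    (a b ahat : C(Θ, ℝ))
    (hA : ∃ θ, a θ > b θ) (hB : ∃ θ, a θ < b θ) :
    BSuperior a b ahat ↔
      ((∀ θ, a θ > b θ → ahat θ > b θ) ∧
        ∃ l : ℝ, l ∈ Set.Icc (0 : ℝ) 1 ∧
          ∀ θ, ahat θ ≥ l * a θ + (1 - l) * b θ) := by
  exact ⟨fun h => ⟨fun _ hθ => h.lt_of_lt hθ, h.exists_mixture_le hA⟩,
    fun ⟨hpos, _, hl, hmix⟩ => bSuperior_of_mixture_le hpos hl hmix⟩
end

section
/- Suppose that for every pair (θ, θ′) ∈ 𝒜 × ℬ there exists λ_{θ,θ′} ∈ [0,1] such that â(θ) ≥ λ_{θ,θ′}·a(θ) + (1−λ_{θ,θ′})·b(θ) and â(θ′) ≥ λ_{θ,θ′}·a(θ′) + (1−λ_{θ,θ′})·b(θ′), that â(θ†) ≥ a(θ†) for every θ† ∈ 𝒞, and that â(θ) ≥ b(θ) for every θ ∈ 𝒜. Then there exists a single λ ∈ [0,1] such that â(θ) ≥ λ·a(θ) + (1−λ)·b(θ) for every θ ∈ Θ, i.e. â weakly dominates a mixture of a and b. -/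
/-- Lemma 2: if `ahat` pairwise-dominates a collection of mixtures of `a` and `b`,
`ahat ≥ a` on 𝒞, and `ahat ≥ b` on 𝒜, then `ahat` dominates a (single) mixture
of `a` and `b`. -/
theorem pairwise_dominance_implies_mixture_dominance {Θ : Type*}
    (a b ahat : Θ → ℝ)
    (hA : ∃ θ, a θ > b θ) (hB : ∃ θ, a θ < b θ)
    (hpair : ∀ θ θ', a θ > b θ → a θ' < b θ' →
      ∃ l : ℝ, l ∈ Set.Icc (0 : ℝ) 1 ∧
        ahat θ ≥ l * a θ + (1 - l) * b θ ∧
        ahat θ' ≥ l * a θ' + (1 - l) * b θ')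
    (hC : ∀ θ, a θ = b θ → ahat θ ≥ a θ)
    (hAb : ∀ θ, a θ > b θ → ahat θ ≥ b θ) :
    ∃ l : ℝ, l ∈ Set.Icc (0 : ℝ) 1 ∧
      ∀ θ, ahat θ ≥ l * a θ + (1 - l) * b θ := by
  let ratio : Θ → ℝ := fun θ => (ahat θ - b θ) / (a θ - b θ)
  let S : Set ℝ := insert 0 (ratio '' {θ | a θ < b θ})
  have ratio_le_iff : ∀ θ, a θ < b θ → ∀ l : ℝ,
      ratio θ ≤ l ↔ l * a θ + (1 - l) * b θ ≤ ahat θ := by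
    intro θ h l
    rw [div_le_iff_of_neg (sub_neg.mpr h)]
    constructor <;> intro <;> linarith
  have le_ratio_iff : ∀ θ, b θ < a θ → ∀ l : ℝ,
      l ≤ ratio θ ↔ l * a θ + (1 - l) * b θ ≤ ahat θ := by
    intro θ h l
    rw [le_div_iff₀ (sub_pos.mpr h)]
    constructor <;> intro <;> linarith
  have upper_one : 1 ∈ upperBounds S := by
    obtain ⟨θ, hθ⟩ := hA
    rintro _ (rfl | ⟨θ', hθ', rfl⟩)
    · exact zero_le_one
    · obtain ⟨l, hl, -, h⟩ := hpair θ θ' hθ hθ'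
      exact ((ratio_le_iff θ' hθ' l).2 h).trans hl.2
  have upper_ratio : ∀ θ, b θ < a θ → ratio θ ∈ upperBounds S := by
    rintro θ hθ _ (rfl | ⟨θ', hθ', rfl⟩)
    · exact (le_ratio_iff θ hθ 0).2 (by linarith [hAb θ hθ])
    · obtain ⟨l, -, h, h'⟩ := hpair θ θ' hθ hθ'
      exact ((ratio_le_iff θ' hθ' l).2 h').trans ((le_ratio_iff θ hθ l).2 h)
  have hS : S.Nonempty := Set.insert_nonempty _ _
  have hbdd : BddAbove S := ⟨1, upper_one⟩
  refine ⟨sSup S, ⟨le_csSup hbdd (Set.mem_insert _ _), csSup_le hS upper_one⟩, fun θ => ?_⟩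
  rcases lt_trichotomy (a θ) (b θ) with h | h | h
  · exact (ratio_le_iff θ h _).1 (le_csSup hbdd (Set.mem_insert_of_mem _ ⟨θ, h, rfl⟩))
  · have := hC θ h
    rw [← h]
    linarith
  · exact (le_ratio_iff θ h _).1 (csSup_le hS (upper_ratio θ h))
end

section
/- With two states 0 and 1 (where a₀ > b₀ and b₁ > a₁), â is b-superior to a if and only if â₀ > b₀ and there exists λ ∈ [0,1] such that for every μ ∈ [0,1], ℓ_â(μ) ≥ λ·ℓ_a(μ) + (1−λ)·ℓ_b(μ), where for any action x, ℓ_x(μ) = x₀(1−μ) + x₁μ. -/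
/-- Two-state b-superiority: for every strictly increasing, concave, continuous
utility `u` and every belief `μ ∈ [0,1]` (the probability of state 1),
preferring `a` to `b` (weakly/strictly) implies preferring `ahat` to `b`
(weakly/strictly). -/
def BSuperior2 (a0 a1 b0 b1 h0 h1 : ℝ) : Prop :=
  ∀ u : ℝ → ℝ, StrictMono u → ConcaveOn ℝ Set.univ u → Continuous u →
    ∀ μ ∈ Set.Icc (0 : ℝ) 1,
      ((1 - μ) * u a0 + μ * u a1 ≥ (1 - μ) * u b0 + μ * u b1 →
        (1 - μ) * u h0 + μ * u h1 ≥ (1 - μ) * u b0 + μ * u b1) ∧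
      ((1 - μ) * u a0 + μ * u a1 > (1 - μ) * u b0 + μ * u b1 →
        (1 - μ) * u h0 + μ * u h1 > (1 - μ) * u b0 + μ * u b1)

/-- At the belief making `a` and `b` indifferent under `u`, b-superiority becomes an inequality
between products of utility differences. -/
theorem BSuperior2.mul_sub_le_mul_sub {a0 a1 b0 b1 h0 h1 : ℝ} (H : BSuperior2 a0 a1 b0 b1 h0 h1)
    (hab0 : b0 < a0) (hab1 : a1 < b1) {u : ℝ → ℝ} (hu : StrictMono u)
    (hconc : ConcaveOn ℝ Set.univ u) (hcont : Continuous u) :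
    (u b1 - u h1) * (u a0 - u b0) ≤ (u h0 - u b0) * (u b1 - u a1) := by
  have hp : 0 < u a0 - u b0 := sub_pos.2 (hu hab0)
  have hq : 0 < u b1 - u a1 := sub_pos.2 (hu hab1)
  have hs : 0 < (u a0 - u b0) + (u b1 - u a1) := add_pos hp hq
  obtain ⟨μ, hμ⟩ : ∃ μ : ℝ, μ * ((u a0 - u b0) + (u b1 - u a1)) = u a0 - u b0 :=
    ⟨_, div_mul_cancel₀ _ hs.ne'⟩
  have hμ0 : 0 ≤ μ := by
    by_contra! h
    nlinarith
  have hμ1 : μ ≤ 1 := by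
    by_contra! h
    nlinarith
  have hle := (H u hu hconc hcont μ ⟨hμ0, hμ1⟩).1 (by linarith)
  have hmul := mul_le_mul_of_nonneg_right hle hs.le
  have hμ' : (1 - μ) * ((u a0 - u b0) + (u b1 - u a1)) = u b1 - u a1 := by linarith
  linear_combination hmul - (u b1 - u h1) * hμ + (u h0 - u b0) * hμ'

theorem strictMono_min_mul_sub {K : ℝ} (hK : 0 < K) (c : ℝ) :
    StrictMono fun x : ℝ => min (x - c) (K * (x - c)) := by
  intro x y hxy
  have h : K * (x - c) < K * (y - c) := by gcongr
  exact min_lt_min (by linarith) h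

theorem concaveOn_min_mul_sub (K c : ℝ) :
    ConcaveOn ℝ Set.univ fun x : ℝ => min (x - c) (K * (x - c)) := by
  have h1 : ConcaveOn ℝ Set.univ fun x : ℝ => x - c :=
    ⟨convex_univ, fun x _ y _ s t _ _ hst => by
      simp only [smul_eq_mul]
      linear_combination -c * hst⟩
  have h2 : ConcaveOn ℝ Set.univ fun x : ℝ => K * (x - c) :=
    ⟨convex_univ, fun x _ y _ s t _ _ hst => by
      simp only [smul_eq_mul]
      linear_combination -(K * c) * hst⟩
  exact h1.inf h2

theorem exists_one_le_and_lt_mul {P : ℝ} (hP : 0 < P) (Q : ℝ) : ∃ K : ℝ, 1 ≤ K ∧ Q < K * P :=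
  ⟨max 1 (Q / P + 1), le_max_left _ _, (div_lt_iff₀ hP).1 <|
    (lt_add_one _).trans_le (le_max_right _ _)⟩

/-- A b-superior action pays at least as much as `a` in state 1: otherwise a utility
with a sharp enough kink at `a1` violates b-superiority. -/
theorem BSuperior2.le_payoff_one {a0 a1 b0 b1 h0 h1 : ℝ} (H : BSuperior2 a0 a1 b0 b1 h0 h1)
    (hab0 : b0 < a0) (hab1 : a1 < b1) (hb0 : b0 < h0) : a1 ≤ h1 := by
  by_contra! hlt
  have key (K : ℝ) (hK : 1 ≤ K) := H.mul_sub_le_mul_sub hab0 hab1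
    (strictMono_min_mul_sub (by linarith) a1) (concaveOn_min_mul_sub K a1) (by fun_prop)
  have above {K x : ℝ} (hK : 1 ≤ K) (hx : a1 ≤ x) : min (x - a1) (K * (x - a1)) = x - a1 :=
    min_eq_left (by nlinarith)
  have below {K x : ℝ} (hK : 1 ≤ K) (hx : x ≤ a1) :
      min (x - a1) (K * (x - a1)) = K * (x - a1) :=
    min_eq_right (by nlinarith)
  have hd : 0 < a1 - h1 := by linarith
  rcases le_or_gt a1 b0 with hb | hb
  · obtain ⟨K, hK, hKlt⟩ := exists_one_le_and_lt_mul
      (mul_pos hd (sub_pos.2 hab0)) ((h0 - b0) * (b1 - a1))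
    have h := key K hK
    simp only [above hK hab1.le, above hK hb, above hK (hb.trans hab0.le),
      above hK (hb.trans hb0.le), above hK le_rfl, below hK hlt.le] at h
    nlinarith [mul_pos (sub_pos.2 hab1) (sub_pos.2 hab0)]
  · have hm : 0 < min a0 a1 - b0 := sub_pos.2 (lt_min hab0 hb)
    obtain ⟨K, hK, hKlt⟩ := exists_one_le_and_lt_mul (mul_pos hd hm) ((h0 - b0) * (b1 - a1))
    have hK0 : 0 < K := by linarith
    have h := key K hK
    simp only [above hK hab1.le, below hK hb.le, above hK le_rfl, below hK hlt.le] at h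
    have hupper : min (h0 - a1) (K * (h0 - a1)) - K * (b0 - a1) ≤ K * (h0 - b0) := by
      linarith [min_le_right (h0 - a1) (K * (h0 - a1))]
    have hlower : K * (min a0 a1 - b0) ≤
        min (a0 - a1) (K * (a0 - a1)) - K * (b0 - a1) := by
      have hmono := (strictMono_min_mul_sub hK0 a1).monotone (min_le_left a0 a1)
      simp only [below hK (min_le_right a0 a1)] at hmono
      linarith
    have hleft : K * (a1 - h1) * (K * (min a0 a1 - b0)) ≤
        (b1 - a1 - K * (h1 - a1)) *
          (min (a0 - a1) (K * (a0 - a1)) - K * (b0 - a1)) :=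
      mul_le_mul (by linarith) hlower (by positivity)
        (by nlinarith [mul_pos hK0 hd])
    have hright := mul_le_mul_of_nonneg_right hupper (sub_pos.2 hab1).le
    have hscaled := mul_lt_mul_of_pos_left hKlt hK0
    simp only [sub_self, sub_zero] at h
    linarith

/-- Payoffs above a mixture of two payoffs have utility above the mixture of their utilities. -/
theorem ConcaveOn.mix_le_of_mix_le {u : ℝ → ℝ} (hconc : ConcaveOn ℝ Set.univ u)
    (hu : Monotone u) {l x y z : ℝ} (hl : l ∈ Set.Icc (0 : ℝ) 1)
    (hz : l * x + (1 - l) * y ≤ z) : l * u x + (1 - l) * u y ≤ u z := by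
  have h := hconc.2 (Set.mem_univ x) (Set.mem_univ y) hl.1 (sub_nonneg.2 hl.2) (by ring)
  simp only [smul_eq_mul] at h
  exact h.trans (hu hz)

theorem bSuperior2_of_mix_le {a0 a1 b0 b1 h0 h1 l : ℝ} (hab1 : a1 < b1) (hb0 : b0 < h0)
    (hl : l ∈ Set.Icc (0 : ℝ) 1) (hl0 : l * a0 + (1 - l) * b0 ≤ h0)
    (hl1 : l * a1 + (1 - l) * b1 ≤ h1) : BSuperior2 a0 a1 b0 b1 h0 h1 := by
  intro u hu hconc _ μ hμ
  have e0 := mul_le_mul_of_nonneg_left (hconc.mix_le_of_mix_le hu.monotone hl hl0)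
    (sub_nonneg.2 hμ.2)
  have e1 := mul_le_mul_of_nonneg_left (hconc.mix_le_of_mix_le hu.monotone hl hl1) hμ.1
  have hdom : l * (((1 - μ) * u a0 + μ * u a1) - ((1 - μ) * u b0 + μ * u b1)) ≤
      ((1 - μ) * u h0 + μ * u h1) - ((1 - μ) * u b0 + μ * u b1) := by
    linarith
  refine ⟨fun h => ?_, fun h => ?_⟩
  · linarith [mul_nonneg hl.1 (sub_nonneg.2 h)]
  · rcases hl.1.eq_or_lt with rfl | hpos
    · have hμ1 : μ < 1 := by
        refine hμ.2.lt_of_ne ?_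
        rintro rfl
        linarith [hu hab1]
      have hstate0 := mul_lt_mul_of_pos_left (hu hb0) (sub_pos.2 hμ1)
      linarith
    · linarith [mul_pos hpos (sub_pos.2 h)]

theorem BSuperior2.exists_mix_le {a0 a1 b0 b1 h0 h1 : ℝ} (H : BSuperior2 a0 a1 b0 b1 h0 h1)
    (hab0 : b0 < a0) (hab1 : a1 < b1) (hb0 : b0 < h0) :
    ∃ l ∈ Set.Icc (0 : ℝ) 1, l * a0 + (1 - l) * b0 ≤ h0 ∧ l * a1 + (1 - l) * b1 ≤ h1 := by
  rcases le_or_gt b1 h1 with hb1 | hb1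
  · exact ⟨0, by simp, by linarith, by linarith⟩
  · have ha1 := H.le_payoff_one hab0 hab1 hb0
    have hlin := H.mul_sub_le_mul_sub hab0 hab1 strictMono_id (concaveOn_id convex_univ)
      continuous_id
    simp only [id] at hlin
    have hq : 0 < b1 - a1 := sub_pos.2 hab1
    have hl0 : (b1 - h1) / (b1 - a1) * (a0 - b0) ≤ h0 - b0 := by
      rwa [div_mul_eq_mul_div, div_le_iff₀ hq]
    have hl1 : (b1 - h1) / (b1 - a1) * (b1 - a1) = b1 - h1 := div_mul_cancel₀ _ hq.ne'
    exact ⟨(b1 - h1) / (b1 - a1),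
      ⟨div_nonneg (by linarith) hq.le, (div_le_one hq).2 (by linarith)⟩,
      by linarith, by linarith⟩

/-- Corollary (two states): `ahat` is b-superior to `a` iff `h0 > b0` and the
line `ℓ_ahat` lies weakly above `λ ℓ_a + (1-λ) ℓ_b` for some `λ ∈ [0,1]`. -/
theorem bSuperior2_iff (a0 a1 b0 b1 h0 h1 : ℝ)
    (hab0 : a0 > b0) (hab1 : b1 > a1) :
    BSuperior2 a0 a1 b0 b1 h0 h1 ↔
      (h0 > b0 ∧ ∃ l : ℝ, l ∈ Set.Icc (0 : ℝ) 1 ∧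
        ∀ μ ∈ Set.Icc (0 : ℝ) 1,
          h0 * (1 - μ) + h1 * μ ≥
            l * (a0 * (1 - μ) + a1 * μ) + (1 - l) * (b0 * (1 - μ) + b1 * μ)) := by
  constructor
  · intro H
    have hb0 : b0 < h0 := by
      simpa using (H id strictMono_id (concaveOn_id convex_univ) continuous_id 0 (by simp)).2
        (by simpa using hab0)
    obtain ⟨l, hl, hl0, hl1⟩ := H.exists_mix_le hab0 hab1 hb0
    refine ⟨hb0, l, hl, fun μ hμ => ?_⟩
    linarith [mul_le_mul_of_nonneg_right hl0 (sub_nonneg.2 hμ.2),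
      mul_le_mul_of_nonneg_right hl1 hμ.1]
  · rintro ⟨hb0, l, hl, h⟩
    exact bSuperior2_of_mix_le hab1 hb0 hl (by simpa using h 0 (by simp))
      (by simpa using h 1 (by simp))
end

section
/- Let L_a, L_â, L_1, …, L_m be simple lotteries (m ≥ 1). L_â B-improves upon L_a with respect to the class of strictly increasing, concave, continuous utilities if and only if for every b ∈ {1, …, m} there exists a convex weight λ ∈ ℝ^m such that the lottery Σ_{i=1}^m λ_i L_i + (1 − Σ_{i=1}^m λ_i) L_â dominates the lottery Σ_{i=1}^m λ_i L_a + (1 − Σ_{i=1}^m λ_i) L_b in the sense that every strictly increasing, concave, continuous u : ℝ → ℝ gives the former weakly higher expected utility than the latter (second-order stochastic dominance). -/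
open MeasureTheory

/-- A simple lottery: a finitely supported Borel probability measure on ℝ. -/
def SimpleLottery (L : Measure ℝ) : Prop :=
  IsProbabilityMeasure L ∧ ∃ s : Finset ℝ, L ((s : Set ℝ))ᶜ = 0

/-- A convex weight: nonnegative entries summing to at most one. -/
def ConvexWeight {m : ℕ} (l : Fin m → ℝ) : Prop :=
  (∀ i, 0 ≤ l i) ∧ ∑ i, l i ≤ 1

/-- The convex combination `∑ i, l i • Ls i + (1 - ∑ i, l i) • L` of measures. -/
noncomputable def mixLottery {m : ℕ} (l : Fin m → ℝ) (Ls : Fin m → Measure ℝ)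
    (L : Measure ℝ) : Measure ℝ :=
  (∑ i, ENNReal.ofReal (l i) • Ls i) + ENNReal.ofReal (1 - ∑ i, l i) • L

/-- Gordan-type alternative: a nonempty convex set disjoint from the open positive orthant lies in
a half-space whose normal is a probability vector. -/
theorem Convex.exists_stdSimplex_sum_mul_nonpos {ι : Type*} [Fintype ι] {C : Set (ι → ℝ)}
    (hC : Convex ℝ C) (hne : C.Nonempty) (h : ∀ x ∈ C, ∃ i, x i ≤ 0) :
    ∃ w ∈ stdSimplex ℝ ι, ∀ x ∈ C, ∑ i, w i * x i ≤ 0 := by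
  classical
  let P : Set (ι → ℝ) := Set.univ.pi fun _ => Set.Ioi 0
  have mem_P (x : ι → ℝ) : x ∈ P ↔ ∀ i, 0 < x i := by simp [P]
  have hPo : IsOpen P := isOpen_set_pi Set.finite_univ fun _ _ => isOpen_Ioi
  have hPc : Convex ℝ P := convex_pi fun _ _ => convex_Ioi 0
  have hd : Disjoint P C := by
    rw [Set.disjoint_left]
    intro x hx hxC
    obtain ⟨i, hi⟩ := h x hxC
    exact absurd ((mem_P x).1 hx i) (not_lt.2 hi)
  obtain ⟨f, c, hfP, hfC⟩ := geometric_hahn_banach_open hPc hPo hC hd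
  have hf (x : ι → ℝ) : f x = ∑ i, f (Pi.single i 1) * x i := by
    conv_lhs => rw [pi_eq_sum_univ' x]
    simp only [map_sum, map_smul, smul_eq_mul]
    refine Finset.sum_congr rfl fun i _ => ?_
    rw [mul_comm]
  have hscale (x : ι → ℝ) (hx : x ∈ P) (t : ℝ) (ht : 0 < t) : t * f x < c := by
    rw [← smul_eq_mul, ← map_smul]
    exact hfP _ ((mem_P _).2 fun i => mul_pos ht ((mem_P x).1 hx i))
  have hone : (1 : ι → ℝ) ∈ P := (mem_P _).2 fun _ => one_pos
  have hc : 0 ≤ c := by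
    by_contra! hc
    have h1 := hscale 1 hone 1 one_pos
    have h2 := hscale 1 hone (c / f 1) (div_pos_of_neg_of_neg hc (by linarith))
    rw [div_mul_cancel₀ _ (by linarith : f 1 < 0).ne] at h2
    exact lt_irrefl _ h2
  have hneg (x : ι → ℝ) (hx : x ∈ P) : f x ≤ 0 := by
    by_contra! hpos
    have h1 := hscale x hx ((c + 1) / f x) (by positivity)
    rw [div_mul_cancel₀ _ hpos.ne'] at h1
    linarith
  have hsingle (i : ι) : f (Pi.single i 1) ≤ 0 := by
    by_contra! hpos
    have h1 := hneg (Pi.single i 1 + (f (Pi.single i 1) / (2 * (|f 1| + 1))) • (1 : ι → ℝ))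
      ((mem_P _).2 fun j => by
        have : (0 : ℝ) ≤ (Pi.single i 1 : ι → ℝ) j := by
          rw [Pi.single_apply]; split_ifs <;> norm_num
        have : 0 < f (Pi.single i 1) / (2 * (|f 1| + 1)) := by positivity
        simp only [Pi.add_apply, Pi.smul_apply, Pi.one_apply, smul_eq_mul]
        linarith)
    rw [map_add, map_smul, smul_eq_mul, div_mul_eq_mul_div] at h1
    have h2 : -f (Pi.single i 1) < f (Pi.single i 1) * f 1 / (2 * (|f 1| + 1)) := by
      rw [lt_div_iff₀ (by positivity)]
      nlinarith [neg_abs_le (f 1), abs_nonneg (f 1)]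
    linarith
  have hf1 : f 1 < 0 := by
    refine lt_of_le_of_ne (hneg 1 hone) fun h0 => ?_
    have hz : ∀ i ∈ Finset.univ, f (Pi.single i 1) = 0 := by
      refine (Finset.sum_eq_zero_iff_of_nonpos fun i _ => hsingle i).1 ?_
      rw [← h0, hf 1]
      simp
    obtain ⟨x, hx⟩ := hne
    have hx0 : f x = 0 := by
      rw [hf x]
      exact Finset.sum_eq_zero fun i hi => by rw [hz i hi, zero_mul]
    linarith [hfC x hx, hfP 1 hone]
  refine ⟨fun i => f (Pi.single i 1) / f 1,
    ⟨fun i => div_nonneg_of_nonpos (hsingle i) hf1.le, ?_⟩, fun x hx => ?_⟩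
  · rw [← Finset.sum_div, div_eq_one_iff_eq hf1.ne, hf 1]
    simp
  · have : ∑ i, f (Pi.single i 1) / f 1 * x i = f x / f 1 := by
      rw [hf x, Finset.sum_div]
      exact Finset.sum_congr rfl fun i _ => by ring
    rw [this]
    exact div_nonpos_of_nonneg_of_nonpos (hc.trans (hfC x hx)) hf1.le

/-- The strictly increasing, concave, continuous utility functions. -/
def riskAverseUtilities : Set (ℝ → ℝ) :=
  {u | StrictMono u ∧ ConcaveOn ℝ Set.univ u ∧ Continuous u}

theorem convex_riskAverseUtilities : Convex ℝ riskAverseUtilities := by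
  rintro u ⟨hu, hu', hu''⟩ v ⟨hv, hv', hv''⟩ a b ha hb hab
  refine ⟨fun x y hxy => ?_, (hu'.smul ha).add (hv'.smul hb),
    (hu''.const_smul a).add (hv''.const_smul b)⟩
  have h1 := hu hxy
  have h2 := hv hxy
  simp only [Pi.add_apply, Pi.smul_apply, smul_eq_mul]
  rcases ha.eq_or_lt with rfl | ha
  · obtain rfl : b = 1 := by linarith
    linarith
  · exact add_lt_add_of_lt_of_le (mul_lt_mul_of_pos_left h1 ha)
      (mul_le_mul_of_nonneg_left h2.le hb)

theorem id_mem_riskAverseUtilities : id ∈ riskAverseUtilities :=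
  ⟨strictMono_id, concaveOn_id convex_univ, continuous_id⟩

theorem SimpleLottery.integrable {L : Measure ℝ} (hL : SimpleLottery L) {u : ℝ → ℝ}
    (hu : Continuous u) : Integrable u L := by
  obtain ⟨_, s, hs⟩ := hL
  refine Integrable.of_bound hu.aestronglyMeasurable (∑ y ∈ s, ‖u y‖) ?_
  filter_upwards [compl_mem_ae_iff.2 hs] with x hx
  rw [compl_compl] at hx
  exact Finset.single_le_sum (f := fun y => ‖u y‖) (fun _ _ => norm_nonneg _)
    (Finset.mem_coe.1 hx)

theorem integral_mixLottery {m : ℕ} {l : Fin m → ℝ} (hl : ConvexWeight l)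
    {Ls : Fin m → Measure ℝ} {L : Measure ℝ} {u : ℝ → ℝ}
    (hLs : ∀ i, Integrable u (Ls i)) (hL : Integrable u L) :
    ∫ x, u x ∂(mixLottery l Ls L) =
      ∑ i, l i * ∫ x, u x ∂(Ls i) + (1 - ∑ i, l i) * ∫ x, u x ∂L := by
  have hi (i : Fin m) : Integrable u (ENNReal.ofReal (l i) • Ls i) :=
    (hLs i).smul_measure ENNReal.ofReal_ne_top
  rw [mixLottery, integral_add_measure (integrable_finsetSum_measure.2 fun i _ => hi i)
    (hL.smul_measure ENNReal.ofReal_ne_top), integral_finsetSum_measure fun i _ => hi i,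
    integral_smul_measure, ENNReal.toReal_ofReal (sub_nonneg.2 hl.2), smul_eq_mul]
  simp only [integral_smul_measure, ENNReal.toReal_ofReal (hl.1 _), smul_eq_mul]

/-- Dominance between the two mixtures, as an inequality between expected-utility differences. -/
theorem integral_mixLottery_ge_iff {m : ℕ} {l : Fin m → ℝ} (hl : ConvexWeight l)
    {La Lh Lb : Measure ℝ} {Ls : Fin m → Measure ℝ} {u : ℝ → ℝ} (ha : Integrable u La)
    (hh : Integrable u Lh) (hb : Integrable u Lb) (hLs : ∀ i, Integrable u (Ls i)) :
    (∫ x, u x ∂(mixLottery l Ls Lh)) ≥ ∫ x, u x ∂(mixLottery l (fun _ => La) Lb) ↔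
      ∑ i, l i * (∫ x, u x ∂La - ∫ x, u x ∂(Ls i)) +
        (1 - ∑ i, l i) * (∫ x, u x ∂Lb - ∫ x, u x ∂Lh) ≤ 0 := by
  rw [integral_mixLottery hl hLs hh, integral_mixLottery hl (fun _ => ha) hb]
  simp only [mul_sub, Finset.sum_sub_distrib]
  constructor <;> intro h <;> linarith

/-- Theorem 3 (risk-averse class): `L_ahat` B-improves upon `L_a` iff for each
`b` there is a convex weight `λ` such that `∑ λ_i L_i + (1-∑λ_i) L_ahat`
second-order stochastically dominates `∑ λ_i L_a + (1-∑λ_i) L_b`. -/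
theorem lottery_improvement_iff_concave {m : ℕ} (hm : 1 ≤ m)
    (La Lh : Measure ℝ) (Ls : Fin m → Measure ℝ)
    (hLa : SimpleLottery La) (hLh : SimpleLottery Lh)
    (hLs : ∀ i, SimpleLottery (Ls i)) :
    (∀ u : ℝ → ℝ, StrictMono u → ConcaveOn ℝ Set.univ u → Continuous u →
      (∀ i, (∫ x, u x ∂La) > ∫ x, u x ∂(Ls i)) →
      (∀ i, (∫ x, u x ∂Lh) ≥ ∫ x, u x ∂(Ls i))) ↔
    (∀ b : Fin m, ∃ l : Fin m → ℝ, ConvexWeight l ∧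
      ∀ u : ℝ → ℝ, StrictMono u → ConcaveOn ℝ Set.univ u → Continuous u →
        (∫ x, u x ∂(mixLottery l Ls Lh)) ≥
          ∫ x, u x ∂(mixLottery l (fun _ => La) (Ls b))) := by
  constructor
  · intro h b
    let Φ : (ℝ → ℝ) → Option (Fin m) → ℝ := fun u o => o.elim
      (∫ x, u x ∂(Ls b) - ∫ x, u x ∂Lh) fun i => ∫ x, u x ∂La - ∫ x, u x ∂(Ls i)
    have hint {L : Measure ℝ} (hL : SimpleLottery L) {u v : ℝ → ℝ} (hu : Continuous u)
        (hv : Continuous v) (s t : ℝ) :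
        ∫ x, s * u x + t * v x ∂L = s * ∫ x, u x ∂L + t * ∫ x, v x ∂L := by
      rw [integral_add ((hL.integrable hu).const_mul s) ((hL.integrable hv).const_mul t),
        integral_const_mul, integral_const_mul]
    have hconv : Convex ℝ (Φ '' riskAverseUtilities) := by
      rintro _ ⟨u, hu, rfl⟩ _ ⟨v, hv, rfl⟩ s t hs ht hst
      refine ⟨s • u + t • v, convex_riskAverseUtilities hu hv hs ht hst, ?_⟩
      have hu := hu.2.2
      have hv := hv.2.2
      funext o
      rcases o with _ | i
      · simp only [Φ, Option.elim, hint hLh hu hv, hint (hLs b) hu hv, Pi.add_apply,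
          Pi.smul_apply, smul_eq_mul]
        ring
      · simp only [Φ, Option.elim, hint hLa hu hv, hint (hLs i) hu hv, Pi.add_apply,
          Pi.smul_apply, smul_eq_mul]
        ring
    obtain ⟨w, ⟨hw0, hw1⟩, hw⟩ := hconv.exists_stdSimplex_sum_mul_nonpos
      ⟨_, id, id_mem_riskAverseUtilities, rfl⟩ (by
        rintro _ ⟨u, ⟨hu, hu', hu''⟩, rfl⟩
        by_contra! hpos
        have h1 := h u hu hu' hu'' (fun i => sub_pos.1 (hpos (some i))) b
        have h2 := hpos none
        simp only [Φ, Option.elim] at h2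
        linarith)
    rw [Fintype.sum_option] at hw1
    have hl : ConvexWeight fun i => w (some i) :=
      ⟨fun i => hw0 _, by linarith [hw0 none]⟩
    refine ⟨fun i => w (some i), hl, fun u hu hu' hu'' => ?_⟩
    rw [integral_mixLottery_ge_iff hl (hLa.integrable hu'') (hLh.integrable hu'')
      ((hLs b).integrable hu'') fun i => (hLs i).integrable hu'', ← hw1]
    have h1 := hw _ ⟨u, ⟨hu, hu', hu''⟩, rfl⟩
    rw [Fintype.sum_option] at h1
    simp only [Φ, Option.elim] at h1
    linarith
  · intro h u hu hu' hu'' hpos b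
    obtain ⟨l, hl, hdom⟩ := h b
    have h1 := (integral_mixLottery_ge_iff hl (hLa.integrable hu'') (hLh.integrable hu'')
      ((hLs b).integrable hu'') fun i => (hLs i).integrable hu'').1 (hdom u hu hu' hu'')
    by_contra! hlt
    have hterm (i : Fin m) : 0 ≤ l i * (∫ x, u x ∂La - ∫ x, u x ∂(Ls i)) :=
      mul_nonneg (hl.1 i) (sub_nonneg.2 (hpos i).le)
    have hsum := Finset.sum_nonneg fun i (_ : i ∈ Finset.univ) => hterm i
    have hmul := mul_nonneg (sub_nonneg.2 hl.2) (sub_nonneg.2 hlt.le)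
    have hl1 : 1 - ∑ i, l i = 0 :=
      (mul_eq_zero.1 (by linarith)).resolve_right (sub_pos.2 hlt).ne'
    have hz := (Finset.sum_eq_zero_iff_of_nonneg fun i _ => hterm i).1 (by linarith)
    have hl0 : ∑ i, l i = 0 := Finset.sum_eq_zero fun i hi =>
      (mul_eq_zero.1 (hz i hi)).resolve_right (sub_pos.2 (hpos i)).ne'
    linarith
end

section
/- Let L_a, L_â, L_b be simple lotteries. L_â b-improves upon L_a with respect to the class of strictly increasing, concave, continuous utilities if and only if there exists λ ∈ [0,1] such that the lottery λ L_b + (1−λ) L_â dominates the lottery λ L_a + (1−λ) L_b in the sense that every strictly increasing, concave, continuous u : ℝ → ℝ gives the former weakly higher expected utility than the latter. -/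
open MeasureTheory

/-- Expected utility is affine in the lottery. -/
theorem integral_ofReal_smul_add_ofReal_smul {μ ν : Measure ℝ} {u : ℝ → ℝ} {a b : ℝ}
    (ha : 0 ≤ a) (hb : 0 ≤ b) (hμ : Integrable u μ) (hν : Integrable u ν) :
    ∫ x, u x ∂(ENNReal.ofReal a • μ + ENNReal.ofReal b • ν) =
      a * ∫ x, u x ∂μ + b * ∫ x, u x ∂ν := by
  rw [integral_add_measure (hμ.smul_measure ENNReal.ofReal_ne_top)
    (hν.smul_measure ENNReal.ofReal_ne_top), integral_smul_measure, integral_smul_measure,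
    ENNReal.toReal_ofReal ha, ENNReal.toReal_ofReal hb, smul_eq_mul, smul_eq_mul]

/-- If an affine function `α x - β y` is bounded above by `c` on the open positive quadrant,
then its slopes are nonpositive and the bound is nonnegative. -/
theorem signs_of_forall_pos_lt {α β c : ℝ}
    (h : ∀ x y : ℝ, 0 < x → 0 < y → α * x - β * y < c) : α ≤ 0 ∧ 0 ≤ β ∧ 0 ≤ c := by
  refine ⟨?_, ?_, ?_⟩
  · by_contra! hα
    have h1 := h ((|c| + |β| + 1) / α) 1 (by positivity) one_pos
    rw [mul_div_cancel₀ _ hα.ne'] at h1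
    linarith [le_abs_self c, le_abs_self β]
  · by_contra! hβ
    have hβ' : 0 < -β := by linarith
    have h1 := h 1 ((|c| + |α| + 1) / (-β)) one_pos (by positivity)
    have h2 : β * ((|c| + |α| + 1) / (-β)) = -(|c| + |α| + 1) := by
      rw [div_neg, mul_neg, mul_div_cancel₀ _ hβ.ne]
    rw [h2] at h1
    linarith [le_abs_self c, neg_abs_le α]
  · by_contra! hc
    have hd : 0 < |α - β| + 1 := by positivity
    have ht : 0 < -c / (|α - β| + 1) := div_pos (by linarith) hd
    have h1 := h _ _ ht ht
    have h2 : -c / (|α - β| + 1) * (|α - β| + 1) = -c := div_mul_cancel₀ _ hd.ne'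
    nlinarith [neg_abs_le (α - β)]

/-- A nonempty convex set in the plane that misses the open fourth quadrant lies on the
upper-left side of a line through the origin with nonnegative (possibly infinite) slope. -/
theorem exists_mem_Icc_forall_mul_le {K : Set (ℝ × ℝ)} (hK : Convex ℝ K) (hne : K.Nonempty)
    (hq : ∀ p ∈ K, 0 < p.1 → 0 ≤ p.2) :
    ∃ l ∈ Set.Icc (0 : ℝ) 1, ∀ p ∈ K, l * p.1 ≤ (1 - l) * p.2 := by
  have hdisj : Disjoint (Set.Ioi (0 : ℝ) ×ˢ Set.Iio (0 : ℝ)) K :=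
    Set.disjoint_left.mpr fun p hp hpK => (hq p hpK hp.1).not_gt hp.2
  obtain ⟨φ, c, hφ, hφK⟩ := geometric_hahn_banach_open
    ((convex_Ioi (0 : ℝ)).prod (convex_Iio (0 : ℝ))) (isOpen_Ioi.prod isOpen_Iio) hK hdisj
  have hφ_eq (x y : ℝ) : φ (x, y) = φ (1, 0) * x + φ (0, 1) * y := by
    have : ((x, y) : ℝ × ℝ) = x • (1, 0) + y • (0, 1) := by simp
    rw [this, map_add, map_smul, map_smul, smul_eq_mul, smul_eq_mul]
    ring
  generalize φ (1, 0) = α at hφ_eq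
  generalize φ (0, 1) = β at hφ_eq
  have hbound (x y : ℝ) (hx : 0 < x) (hy : 0 < y) : α * x - β * y < c := by
    have := hφ (x, -y) ⟨hx, neg_lt_zero.mpr hy⟩
    rw [hφ_eq] at this
    linarith
  obtain ⟨hα, hβ, hc⟩ := signs_of_forall_pos_lt hbound
  have hpos : 0 < β - α := by
    rcases (sub_nonneg.mpr (hα.trans hβ)).lt_or_eq with h | h
    · exact h
    · obtain ⟨p, hp⟩ := hne
      have hα0 : α = 0 := by linarith
      have hβ0 : β = 0 := by linarith
      have h1 := hbound 1 1 one_pos one_pos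
      have h2 := hφK p hp
      rw [← Prod.mk.eta (p := p), hφ_eq] at h2
      simp only [hα0, hβ0] at h1 h2
      linarith
  refine ⟨-α / (β - α), ⟨div_nonneg (by linarith) hpos.le, (div_le_one hpos).mpr (by linarith)⟩,
    fun p hp => ?_⟩
  have h2 := hφK p hp
  rw [← Prod.mk.eta (p := p), hφ_eq] at h2
  have h3 : 1 - -α / (β - α) = β / (β - α) := by field_simp; ring
  rw [h3, div_mul_eq_mul_div, div_mul_eq_mul_div]
  exact div_le_div_of_nonneg_right (by linarith) hpos.le

/-- Corollary (two actions, risk-averse class): `L_ahat` b-improves upon `L_a`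
iff there exists `λ ∈ [0,1]` such that `λ L_b + (1-λ) L_ahat` second-order
stochastically dominates `λ L_a + (1-λ) L_b`. -/
theorem lottery_improvement_iff_two_actions
    (La Lh Lb : Measure ℝ)
    (hLa : SimpleLottery La) (hLh : SimpleLottery Lh) (hLb : SimpleLottery Lb) :
    (∀ u : ℝ → ℝ, StrictMono u → ConcaveOn ℝ Set.univ u → Continuous u →
      (∫ x, u x ∂La) > (∫ x, u x ∂Lb) → (∫ x, u x ∂Lh) ≥ (∫ x, u x ∂Lb)) ↔
    (∃ l : ℝ, l ∈ Set.Icc (0 : ℝ) 1 ∧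
      ∀ u : ℝ → ℝ, StrictMono u → ConcaveOn ℝ Set.univ u → Continuous u →
        (∫ x, u x ∂(ENNReal.ofReal l • Lb + ENNReal.ofReal (1 - l) • Lh)) ≥
          ∫ x, u x ∂(ENNReal.ofReal l • La + ENNReal.ofReal (1 - l) • Lb)) := by
  have hexp (l : ℝ) (hl : l ∈ Set.Icc (0 : ℝ) 1) (u : ℝ → ℝ) (hu : Continuous u) :
      ((∫ x, u x ∂(ENNReal.ofReal l • Lb + ENNReal.ofReal (1 - l) • Lh)) ≥
          ∫ x, u x ∂(ENNReal.ofReal l • La + ENNReal.ofReal (1 - l) • Lb)) ↔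
        l * (∫ x, u x ∂La - ∫ x, u x ∂Lb) ≤ (1 - l) * (∫ x, u x ∂Lh - ∫ x, u x ∂Lb) := by
    have hl' : 0 ≤ 1 - l := sub_nonneg.mpr hl.2
    rw [integral_ofReal_smul_add_ofReal_smul hl.1 hl' (hLb.integrable hu) (hLh.integrable hu),
      integral_ofReal_smul_add_ofReal_smul hl.1 hl' (hLa.integrable hu) (hLb.integrable hu)]
    constructor <;> intro h <;> linarith
  constructor
  · intro H
    let F : (ℝ → ℝ) → ℝ × ℝ := fun u =>
      (∫ x, u x ∂La - ∫ x, u x ∂Lb, ∫ x, u x ∂Lh - ∫ x, u x ∂Lb)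
    have hconv : Convex ℝ (F '' {u | StrictMono u ∧ ConcaveOn ℝ Set.univ u ∧ Continuous u}) := by
      rintro _ ⟨u, ⟨hum, huc, hu⟩, rfl⟩ _ ⟨v, ⟨hvm, hvc, hv⟩, rfl⟩ a b ha hb hab
      refine ⟨a • u + b • v, ⟨?_, (huc.smul ha).add (hvc.smul hb),
        (hu.const_smul a).add (hv.const_smul b)⟩, ?_⟩
      · intro x y hxy
        have h1 := hum hxy
        have h2 := hvm hxy
        simp only [Pi.add_apply, Pi.smul_apply, smul_eq_mul]
        rcases ha.eq_or_lt with rfl | ha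
        · have hb1 : b = 1 := by linarith
          simpa [hb1] using h2
        · exact add_lt_add_of_lt_of_le (mul_lt_mul_of_pos_left h1 ha)
            (mul_le_mul_of_nonneg_left h2.le hb)
      · have hint {L : Measure ℝ} (hL : SimpleLottery L) :
            ∫ x, (a • u + b • v) x ∂L = a * ∫ x, u x ∂L + b * ∫ x, v x ∂L := by
          simp only [Pi.add_apply, Pi.smul_apply, smul_eq_mul]
          rw [integral_add ((hL.integrable hu).const_mul a) ((hL.integrable hv).const_mul b),
            integral_const_mul, integral_const_mul]
        simp only [F, hint hLa, hint hLh, hint hLb, Prod.smul_mk, Prod.mk_add_mk, smul_eq_mul]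
        ext <;> dsimp only <;> ring
    obtain ⟨l, hl, hle⟩ := exists_mem_Icc_forall_mul_le hconv
      ⟨_, id, ⟨strictMono_id, concaveOn_id convex_univ, continuous_id⟩, rfl⟩ (by
        rintro _ ⟨u, ⟨hum, huc, hu⟩, rfl⟩ h
        exact sub_nonneg.mpr (H u hum huc hu (sub_pos.mp h)))
    exact ⟨l, hl, fun u hum huc hu =>
      (hexp l hl u hu).mpr (hle _ ⟨u, ⟨hum, huc, hu⟩, rfl⟩)⟩
  · rintro ⟨l, hl, H⟩ u hum huc hu hgt
    have h := (hexp l hl u hu).mp (H u hum huc hu)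
    by_contra! hlt
    rcases hl.1.eq_or_lt with rfl | hl0
    · linarith
    · nlinarith [mul_pos hl0 (sub_pos.mpr hgt),
        mul_nonneg (sub_nonneg.mpr hl.2) (sub_pos.mpr hlt).le]
end

section
/- Let Θ be a finite set of n ≥ 2 states, A a finite set of at least two actions (vectors in ℝ^Θ), a ∈ A, B = A \ {a}, and let P_a = {μ ∈ Δ : μ·a ≥ μ·b for all b ∈ B}, where Δ ⊂ ℝ^Θ is the probability simplex and μ·x denotes the expectation Σ_θ μ(θ)x(θ). Suppose (i) â(θ) > max_{b∈B} b(θ) for every θ with a(θ) > max_{b∈B} b(θ), and (ii) μ·â ≥ μ·a for every extreme point μ of P_a. Then â u-improves upon a: for every μ ∈ Δ, μ·a ≥ max_{b∈B} μ·b implies μ·â ≥ max_{b∈B} μ·b, and μ·a > max_{b∈B} μ·b implies μ·â > max_{b∈B} μ·b. -/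
/-- On a compact convex set, a lower bound for a continuous linear functional at the extreme points
holds everywhere. -/
theorem IsCompact.le_of_le_on_extremePoints {E : Type*} [AddCommGroup E] [Module ℝ E]
    [TopologicalSpace E] [T2Space E] [IsTopologicalAddGroup E] [ContinuousSMul ℝ E]
    [LocallyConvexSpace ℝ E] {s : Set E} (hs : IsCompact s) (hc : Convex ℝ s)
    (f : E →L[ℝ] ℝ) {r : ℝ} (h : ∀ x ∈ s.extremePoints ℝ, r ≤ f x) :
    ∀ x ∈ s, r ≤ f x := by
  intro x hx
  rw [← closure_convexHull_extremePoints hs hc] at hx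
  exact closure_minimal (convexHull_min h (convex_halfSpace_ge f.isLinear r))
    (isClosed_le continuous_const f.continuous) hx

/-- The payoff of an action `c` as a continuous linear functional of the belief. -/
noncomputable def expectedPayoff {Θ : Type*} [Fintype Θ] (c : Θ → ℝ) : (Θ → ℝ) →L[ℝ] ℝ :=
  ∑ θ, c θ • ContinuousLinearMap.proj θ

theorem expectedPayoff_apply {Θ : Type*} [Fintype Θ] (c μ : Θ → ℝ) :
    expectedPayoff c μ = ∑ θ, μ θ * c θ := by
  simp [expectedPayoff, mul_comm]

/-- The beliefs at which `a` is weakly better than every action in `B` form a compact convex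
set. -/
theorem isCompact_and_convex_optimalBeliefs {Θ : Type*} [Fintype Θ] (B : Finset (Θ → ℝ))
    (a : Θ → ℝ) :
    IsCompact {μ ∈ stdSimplex ℝ Θ | ∀ b ∈ B, ∑ θ, μ θ * a θ ≥ ∑ θ, μ θ * b θ} ∧
      Convex ℝ {μ ∈ stdSimplex ℝ Θ | ∀ b ∈ B, ∑ θ, μ θ * a θ ≥ ∑ θ, μ θ * b θ} := by
  have heq : {μ ∈ stdSimplex ℝ Θ | ∀ b ∈ B, ∑ θ, μ θ * a θ ≥ ∑ θ, μ θ * b θ} =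
      stdSimplex ℝ Θ ∩ ⋂ b ∈ B, {μ | 0 ≤ (expectedPayoff a - expectedPayoff b) μ} := by
    ext μ
    simp [expectedPayoff_apply]
  rw [heq]
  exact ⟨(isCompact_stdSimplex ℝ Θ).inter_right <| isClosed_biInter fun b _ =>
      isClosed_le continuous_const (expectedPayoff a - expectedPayoff b).continuous,
    (convex_stdSimplex ℝ Θ).inter <| convex_iInter₂ fun b _ =>
      convex_halfSpace_ge (expectedPayoff a - expectedPayoff b).isLinear 0⟩


/-- Theorem 4 (known utility, risk-neutral DM): if `ahat θ > max_{b ∈ B} b θ`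
whenever `a θ > max_{b ∈ B} b θ`, and `μ ⬝ ahat ≥ μ ⬝ a` at every extreme point
of the polytope `P_a` of beliefs at which `a` is optimal, then `ahat`
u-improves upon `a`. -/
theorem u_improvement {Θ : Type*} [Fintype Θ] (hn : 2 ≤ Fintype.card Θ)
    (A : Finset (Θ → ℝ)) (hcard : 2 ≤ A.card)
    (a : Θ → ℝ) (ha : a ∈ A) (ahat : Θ → ℝ)
    (hi : ∀ θ : Θ, (∀ b ∈ A.erase a, a θ > b θ) →
      ∀ b ∈ A.erase a, ahat θ > b θ)
    (hii : ∀ μ ∈ Set.extremePoints ℝ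
        {μ ∈ stdSimplex ℝ Θ | ∀ b ∈ A.erase a, ∑ θ, μ θ * a θ ≥ ∑ θ, μ θ * b θ},
      ∑ θ, μ θ * ahat θ ≥ ∑ θ, μ θ * a θ) :
    ∀ μ ∈ stdSimplex ℝ Θ,
      ((∀ b ∈ A.erase a, ∑ θ, μ θ * a θ ≥ ∑ θ, μ θ * b θ) →
        ∀ b ∈ A.erase a, ∑ θ, μ θ * ahat θ ≥ ∑ θ, μ θ * b θ) ∧
      ((∀ b ∈ A.erase a, ∑ θ, μ θ * a θ > ∑ θ, μ θ * b θ) →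
        ∀ b ∈ A.erase a, ∑ θ, μ θ * ahat θ > ∑ θ, μ θ * b θ) := by
  have key : ∀ μ ∈ stdSimplex ℝ Θ, (∀ b ∈ A.erase a, ∑ θ, μ θ * a θ ≥ ∑ θ, μ θ * b θ) →
      ∑ θ, μ θ * a θ ≤ ∑ θ, μ θ * ahat θ := by
    intro μ hμ hopt
    obtain ⟨hcompact, hconvex⟩ := isCompact_and_convex_optimalBeliefs (A.erase a) a
    have h := hcompact.le_of_le_on_extremePoints hconvex
      (expectedPayoff ahat - expectedPayoff a) (r := 0)
      (fun ν hν => by simpa [expectedPayoff_apply] using hii ν hν) μ ⟨hμ, hopt⟩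
    simpa [expectedPayoff_apply] using h
  intro μ hμ
  exact ⟨fun h b hb => (h b hb).trans (key μ hμ h),
    fun h b hb => (h b hb).trans_le (key μ hμ fun c hc => (h c hc).le)⟩
end

section
/- Fix a finite set A of at least two continuous actions satisfying richness and single-peakedness, fix a ∈ A and let B = A \ {a}. A continuous action â is B-superior to a if and only if (i) â(θ) > max_{b∈B} b(θ) for every θ ∈ 𝒜_B, and (ii) for every b ∈ B there exists λ_b ∈ [0,1] such that â(θ) ≥ λ_b·a(θ) + (1−λ_b)·b(θ) for every θ ∈ Θ, i.e., â weakly dominates a mixture of a and b for every b ∈ B. -/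
open MeasureTheory

/-- Action `ahat` is B-superior to `a`: for every strictly increasing, concave,
continuous utility and every Borel probability measure (belief), if `a` is
weakly (resp. strictly) preferred to every action in `B`, then so is `ahat`.
(Since `B` is finite and nonempty, `≥ max` is equivalent to `≥` against every
element, and likewise for strict inequalities.) -/
def BSuperiorMany {Θ : Type*} [TopologicalSpace Θ] [MeasurableSpace Θ]
    (B : Finset C(Θ, ℝ)) (a ahat : C(Θ, ℝ)) : Prop :=
  ∀ u : ℝ → ℝ, StrictMono u → ConcaveOn ℝ Set.univ u → Continuous u →
    ∀ μ : Measure Θ, IsProbabilityMeasure μ →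
      ((∀ b ∈ B, (∫ θ, u (a θ) ∂μ) ≥ ∫ θ, u (b θ) ∂μ) →
        ∀ b ∈ B, (∫ θ, u (ahat θ) ∂μ) ≥ ∫ θ, u (b θ) ∂μ) ∧
      ((∀ b ∈ B, (∫ θ, u (a θ) ∂μ) > ∫ θ, u (b θ) ∂μ) →
        ∀ b ∈ B, (∫ θ, u (ahat θ) ∂μ) > ∫ θ, u (b θ) ∂μ)

section BSuperior

variable {Θ : Type*} [TopologicalSpace Θ] [CompactSpace Θ]
  [TopologicalSpace.MetrizableSpace Θ] [MeasurableSpace Θ] [BorelSpace Θ]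

lemma integrable_comp_of_compactSpace {u : ℝ → ℝ} (hu : Continuous u) (f : C(Θ, ℝ))
    (μ : Measure Θ) [IsFiniteMeasure μ] : Integrable (fun θ => u (f θ)) μ :=
  (hu.comp f.continuous).integrable_of_hasCompactSupport (HasCompactSupport.of_compactSpace _)

/-- For every convex combination of two states there is a belief computing it. -/
lemma exists_probabilityMeasure_integral_eq_pair (θ₁ θ₂ : Θ) {p : ℝ} (h0 : 0 ≤ p) (h1 : p ≤ 1) :
    ∃ μ : Measure Θ, IsProbabilityMeasure μ ∧ ∀ u : ℝ → ℝ, Continuous u → ∀ f : C(Θ, ℝ),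
      ∫ θ, u (f θ) ∂μ = p * u (f θ₁) + (1 - p) * u (f θ₂) := by
  refine ⟨ENNReal.ofReal p • Measure.dirac θ₁ + ENNReal.ofReal (1 - p) • Measure.dirac θ₂,
    ⟨?_⟩, fun u hu f => ?_⟩
  · simp [← ENNReal.ofReal_add h0 (sub_nonneg.2 h1)]
  · rw [integral_add_measure, integral_smul_measure, integral_smul_measure, integral_dirac,
      integral_dirac, ENNReal.toReal_ofReal h0, ENNReal.toReal_ofReal (sub_nonneg.2 h1)]
    · simp
    · exact (integrable_comp_of_compactSpace hu f _).smul_measure ENNReal.ofReal_ne_top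
    · exact (integrable_comp_of_compactSpace hu f _).smul_measure ENNReal.ofReal_ne_top

variable {B : Finset C(Θ, ℝ)} {a ahat : C(Θ, ℝ)}

lemma BSuperiorMany.lt_of_lt (h : BSuperiorMany B a ahat) {θ : Θ} (hθ : ∀ b ∈ B, b θ < a θ) :
    ∀ b ∈ B, b θ < ahat θ := by
  have := (h id strictMono_id (concaveOn_id convex_univ) continuous_id (Measure.dirac θ)
    inferInstance).2
  simp only [id, integral_dirac] at this
  exact this hθ

/-- Mixing a state where `a` is strictly optimal with one where it is not, up to the point where
`a` becomes indifferent to its best competitor `d`, bounds the loss of `ahat` relative to `a`. -/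
lemma BSuperiorMany.exists_indifferent (h : BSuperiorMany B a ahat) {u : ℝ → ℝ}
    (hu : StrictMono u) (hconc : ConcaveOn ℝ Set.univ u) (hcont : Continuous u) {θ₁ θ₂ : Θ}
    (h₁ : ∀ b ∈ B, b θ₁ < a θ₁) (h₂ : ∃ b ∈ B, a θ₂ ≤ b θ₂) :
    ∃ d ∈ B, ∃ r : ℝ, 0 ≤ r ∧ r * (u (a θ₁) - u (d θ₁)) = u (d θ₂) - u (a θ₂) ∧
      (∀ b ∈ B, u (b θ₂) - u (a θ₂) ≤ r * (u (a θ₁) - u (b θ₁))) ∧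
      0 ≤ r * (u (ahat θ₁) - u (a θ₁)) + (u (ahat θ₂) - u (a θ₂)) := by
  obtain ⟨b₀, hb₀, hab₀⟩ := h₂
  have hpos : ∀ b ∈ B, 0 < u (a θ₁) - u (b θ₁) := fun b hb => sub_pos.2 (hu (h₁ b hb))
  obtain ⟨d, hd, hmax⟩ := B.exists_max_image
    (fun b => (u (b θ₂) - u (a θ₂)) / (u (a θ₁) - u (b θ₁))) ⟨b₀, hb₀⟩
  obtain ⟨r, hr⟩ : ∃ r, r = (u (d θ₂) - u (a θ₂)) / (u (a θ₁) - u (d θ₁)) := ⟨_, rfl⟩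
  rw [← hr] at hmax
  have hr0 : 0 ≤ r :=
    (div_nonneg (sub_nonneg.2 (hu.monotone hab₀)) (hpos b₀ hb₀).le).trans (hmax b₀ hb₀)
  have heq : r * (u (a θ₁) - u (d θ₁)) = u (d θ₂) - u (a θ₂) := by
    rw [hr, div_mul_cancel₀ _ (hpos d hd).ne']
  have hle : ∀ b ∈ B, u (b θ₂) - u (a θ₂) ≤ r * (u (a θ₁) - u (b θ₁)) := fun b hb =>
    (div_le_iff₀ (hpos b hb)).1 (hmax b hb)
  refine ⟨d, hd, r, hr0, heq, hle, ?_⟩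
  have hr1 : 0 < 1 + r := by positivity
  obtain ⟨μ, hμ, hint⟩ := exists_probabilityMeasure_integral_eq_pair θ₁ θ₂
    (p := r / (1 + r)) (by positivity) ((div_le_one hr1).2 (by linarith))
  have hint' : ∀ f : C(Θ, ℝ), ∫ θ, u (f θ) ∂μ = (r * u (f θ₁) + u (f θ₂)) / (1 + r) := by
    intro f
    rw [hint u hcont f]
    field_simp
    ring
  have key := (h u hu hconc hcont μ hμ).1 (fun b hb => by
    rw [hint', hint', ge_iff_le, div_le_div_iff_of_pos_right hr1]
    linarith [hle b hb]) d hd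
  rw [hint', hint', ge_iff_le, div_le_div_iff_of_pos_right hr1] at key
  linarith

/-- Concavity bounds an upward increment by the slope of a preceding one. -/
lemma ConcaveOn.sub_mul_le_sub_mul {u : ℝ → ℝ} (hu : ConcaveOn ℝ Set.univ u) {x y z : ℝ}
    (hxy : x < y) (hyz : y < z) : (u z - u y) * (y - x) ≤ (u y - u x) * (z - y) := by
  have := hu.slope_anti_adjacent (Set.mem_univ x) (Set.mem_univ z) hxy hyz
  rwa [div_le_div_iff₀ (sub_pos.2 hyz) (sub_pos.2 hxy)] at this

/-- A `B`-superior action is at least as good as `a` in every state where `a` is not strictly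
optimal. -/
lemma BSuperiorMany.le_of_le (h : BSuperiorMany B a ahat)
    (hrich : ∃ θ, ∀ b ∈ B, b θ < a θ) {θ₂ : Θ} (h₂ : ∃ b ∈ B, a θ₂ ≤ b θ₂) :
    a θ₂ ≤ ahat θ₂ := by
  obtain ⟨θ₁, h₁⟩ := hrich
  by_contra! hlt
  obtain ⟨C, hC⟩ : ∃ C : ℝ, ∀ d ∈ B,
      (ahat θ₁ - a θ₁) / (a θ₁ - d θ₁) * (d θ₂ - a θ₂) / (a θ₂ - ahat θ₂) ≤ C :=
    (B.finite_toSet.image fun d : C(Θ, ℝ) =>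
      (ahat θ₁ - a θ₁) / (a θ₁ - d θ₁) * (d θ₂ - a θ₂) / (a θ₂ - ahat θ₂)).bddAbove.imp
        fun _ hC d hd => hC ⟨d, hd, rfl⟩
  obtain ⟨M, hM1, hMC⟩ : ∃ M : ℝ, 1 ≤ M ∧ C < M :=
    ⟨max 1 (C + 1), le_max_left _ _, (lt_add_one C).trans_le (le_max_right _ _)⟩
  obtain ⟨u, hu⟩ : ∃ u : ℝ → ℝ, u = fun x => min (x - a θ₂) (M * (x - a θ₂)) := ⟨_, rfl⟩
  have hmono : StrictMono u := by
    intro x y hxy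
    rw [hu]
    exact min_lt_min (by linarith) (by nlinarith)
  have hconc : ConcaveOn ℝ Set.univ u := by
    have h1 : ConcaveOn ℝ Set.univ (fun x : ℝ => x - a θ₂) :=
      (concaveOn_id (𝕜 := ℝ) convex_univ).add_const (-a θ₂)
    have h2 : ConcaveOn ℝ Set.univ (fun x : ℝ => M * (x - a θ₂)) :=
      h1.smul (zero_le_one.trans hM1)
    rw [hu]
    exact h1.inf h2
  have hcont : Continuous u := by rw [hu]; fun_prop
  obtain ⟨d, hd, r, hr0, heq, -, hge⟩ := h.exists_indifferent hmono hconc hcont h₁ h₂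
  have hua : u (a θ₂) = 0 := by simp [hu]
  have huhat : u (ahat θ₂) = -(M * (a θ₂ - ahat θ₂)) := by
    rw [hu]
    simp only
    rw [min_eq_right (by nlinarith)]
    ring
  have hud : u (d θ₂) ≤ d θ₂ - a θ₂ := by rw [hu]; exact min_le_left _ _
  have hda := h₁ d hd
  have hpos : 0 < a θ₂ - ahat θ₂ := sub_pos.2 hlt
  rw [hua, huhat] at hge
  rw [hua] at heq
  rcases le_or_gt (ahat θ₁) (a θ₁) with hle | hgt
  · have := hmono.monotone hle
    nlinarith
  · have hslope := hconc.sub_mul_le_sub_mul hda hgt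
    have hCd := (div_lt_iff₀ hpos).1 ((hC d hd).trans_lt hMC)
    have hpos' : 0 < a θ₁ - d θ₁ := sub_pos.2 hda
    rw [div_mul_eq_mul_div, div_lt_iff₀ hpos'] at hCd
    have e1 := mul_le_mul_of_nonneg_left hslope hr0
    have e2 : (ahat θ₁ - a θ₁) * u (d θ₂) ≤ (ahat θ₁ - a θ₁) * (d θ₂ - a θ₂) :=
      mul_le_mul_of_nonneg_left hud (by linarith)
    have e3 : r * ((u (a θ₁) - u (d θ₁)) * (ahat θ₁ - a θ₁)) = (ahat θ₁ - a θ₁) * u (d θ₂) := by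
      linear_combination (ahat θ₁ - a θ₁) * heq
    have e4 := mul_nonneg hge hpos'.le
    linarith

/-- A `B`-superior action weakly dominates a mixture of `a` and each `b ∈ B`. -/
lemma BSuperiorMany.exists_mixture_le (h : BSuperiorMany B a ahat)
    (hrich : ∃ θ, ∀ b ∈ B, b θ < a θ) {b : C(Θ, ℝ)} (hb : b ∈ B) :
    ∃ l ∈ Set.Icc (0 : ℝ) 1, ∀ θ, l * a θ + (1 - l) * b θ ≤ ahat θ := by
  let S : Set ℝ := insert 0 ((fun θ => (b θ - ahat θ) / (b θ - a θ)) '' {θ | a θ < b θ})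
  have hS1 : ∀ x ∈ S, x ≤ 1 := by
    rintro x (rfl | ⟨θ, hθ, rfl⟩)
    · exact zero_le_one
    · rw [Set.mem_ofPred_eq] at hθ
      have := h.le_of_le hrich ⟨b, hb, hθ.le⟩
      exact (div_le_one (sub_pos.2 hθ)).2 (by linarith)
  have hbdd : BddAbove S := ⟨1, hS1⟩
  have h0 : 0 ≤ sSup S := le_csSup hbdd (Set.mem_insert _ _)
  have h1 : sSup S ≤ 1 := csSup_le (Set.insert_nonempty _ _) hS1
  refine ⟨sSup S, ⟨h0, h1⟩, fun θ => ?_⟩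
  rcases lt_or_ge (a θ) (b θ) with hab | hab
  · have : (b θ - ahat θ) / (b θ - a θ) ≤ sSup S :=
      le_csSup hbdd (Set.mem_insert_of_mem _ ⟨θ, hab, rfl⟩)
    rw [div_le_iff₀ (sub_pos.2 hab)] at this
    linarith
  rcases le_or_gt (a θ) (ahat θ) with hle | hlt
  · nlinarith
  have hstrict : ∀ d ∈ B, d θ < a θ := by
    by_contra! hcon
    exact hlt.not_ge (h.le_of_le hrich hcon)
  have hpos : 0 < a θ - b θ := sub_pos.2 (hstrict b hb)
  have hbound : sSup S ≤ (ahat θ - b θ) / (a θ - b θ) := by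
    refine csSup_le (Set.insert_nonempty _ _) ?_
    rintro x (rfl | ⟨θ₂, hθ₂, rfl⟩)
    · exact div_nonneg (sub_nonneg.2 (h.lt_of_lt hstrict b hb).le) hpos.le
    · rw [Set.mem_ofPred_eq] at hθ₂
      obtain ⟨-, -, r, -, -, hr, hge⟩ := h.exists_indifferent strictMono_id
        (concaveOn_id convex_univ) continuous_id hstrict ⟨b, hb, hθ₂.le⟩
      have hrb := hr b hb
      simp only [id] at hrb hge
      rw [div_le_div_iff₀ (sub_pos.2 hθ₂) hpos]
      have e1 := mul_le_mul_of_nonneg_right hrb (sub_pos.2 hlt).le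
      have e2 := mul_nonneg hge hpos.le
      linarith
  rw [le_div_iff₀ hpos] at hbound
  linarith

/-- Dominating mixtures of `a` with each `b ∈ B`, and beating `B` where `a` does, is sufficient
for `B`-superiority. -/
lemma bSuperiorMany_of_exists_mixture_le
    (hi : ∀ θ, (∀ b ∈ B, b θ < a θ) → ∀ b ∈ B, b θ < ahat θ)
    (hii : ∀ b ∈ B, ∃ l ∈ Set.Icc (0 : ℝ) 1, ∀ θ, l * a θ + (1 - l) * b θ ≤ ahat θ) :
    BSuperiorMany B a ahat := by
  intro u hu hconc hcont μ hμ
  have hint (f : C(Θ, ℝ)) : Integrable (fun θ => u (f θ)) μ :=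
    integrable_comp_of_compactSpace hcont f μ
  have hmix : ∀ b ∈ B, ∃ l ∈ Set.Icc (0 : ℝ) 1, (∀ θ, l * a θ + (1 - l) * b θ ≤ ahat θ) ∧
      l * ∫ θ, u (a θ) ∂μ + (1 - l) * ∫ θ, u (b θ) ∂μ ≤ ∫ θ, u (ahat θ) ∂μ := by
    intro b hb
    obtain ⟨l, hl, hdom⟩ := hii b hb
    refine ⟨l, hl, hdom, ?_⟩
    rw [← integral_const_mul, ← integral_const_mul,
      ← integral_add ((hint a).const_mul l) ((hint b).const_mul (1 - l))]
    refine integral_mono (((hint a).const_mul l).add ((hint b).const_mul (1 - l))) (hint ahat)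
      fun θ => ?_
    exact (hconc.2 (Set.mem_univ (a θ)) (Set.mem_univ (b θ)) hl.1 (sub_nonneg.2 hl.2)
      (by ring)).trans (hu.monotone (hdom θ))
  refine ⟨fun hopt b hb => ?_, fun hopt b hb => ?_⟩
  · obtain ⟨l, hl, -, hle⟩ := hmix b hb
    nlinarith [hopt b hb, hl.1]
  · obtain ⟨l, hl, hdom, hle⟩ := hmix b hb
    rcases hl.1.eq_or_lt with rfl | hl0
    · have hba : ∀ θ, b θ ≤ ahat θ := fun θ => by simpa using hdom θ
      refine (integral_mono (hint b) (hint ahat) fun θ => hu.monotone (hba θ)).lt_of_ne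
        fun heq => (hopt b hb).not_ge ?_
      have hae := (integral_eq_iff_of_ae_le (hint b) (hint ahat)
        (Filter.Eventually.of_forall fun θ => hu.monotone (hba θ))).1 heq
      refine integral_mono_ae (hint a) (hint b) ?_
      filter_upwards [hae] with θ hθ
      have hθ' : b θ = ahat θ := hu.injective hθ
      refine hu.monotone ?_
      rw [hθ']
      by_contra! hlt
      by_cases hstrict : ∀ d ∈ B, d θ < a θ
      · exact (hi θ hstrict b hb).ne hθ'
      · push Not at hstrict
        obtain ⟨d, hd, had⟩ := hstrict
        obtain ⟨l, hl, hdom'⟩ := hii d hd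
        nlinarith [hdom' θ, hl.1, hl.2]
    · nlinarith [hopt b hb]

end BSuperior

-- Proposition: under richness and single-peakedness, `ahat` is B-superior to
-- `a` iff (i) `ahat θ` exceeds every `b θ`, `b ∈ B`, on `𝒜_B`, and (ii) for
-- every `b ∈ B`, `ahat` weakly dominates a mixture of `a` and `b`.
open scoped Classical in
theorem bSuperiorMany_iff {Θ : Type*} [TopologicalSpace Θ] [CompactSpace Θ]
    [TopologicalSpace.MetrizableSpace Θ] [MeasurableSpace Θ] [BorelSpace Θ]
    (A : Finset C(Θ, ℝ)) (hcard : 2 ≤ A.card)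
    (a : C(Θ, ℝ)) (ha : a ∈ A)
    (rich : ∀ c ∈ A, ∃ θ : Θ, ∀ d ∈ A, d ≠ c → c θ > d θ)
    (singlePeaked : ∀ c ∈ A, ∀ θ θ' : Θ,
      (∃ l ∈ Set.Icc (0 : ℝ) 1, ∀ d ∈ A, d ≠ c →
        l * c θ + (1 - l) * c θ' ≥ l * d θ + (1 - l) * d θ') ∨
      (∃ d ∈ A, d ≠ c ∧ d θ ≥ c θ ∧ d θ' ≥ c θ'))
    (ahat : C(Θ, ℝ)) :
    BSuperiorMany (A.erase a) a ahat ↔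
      ((∀ θ : Θ, (∀ b ∈ A.erase a, a θ > b θ) → ∀ b ∈ A.erase a, ahat θ > b θ) ∧
        ∀ b ∈ A.erase a, ∃ l ∈ Set.Icc (0 : ℝ) 1,
          ∀ θ, ahat θ ≥ l * a θ + (1 - l) * b θ) := by
  have hmem : ∀ b ∈ A.erase a, b ∈ A ∧ b ≠ a := fun b hb =>
    ⟨Finset.mem_of_mem_erase hb, Finset.ne_of_mem_erase hb⟩
  obtain ⟨θ, hθ⟩ := rich a ha
  have hrich : ∃ θ, ∀ b ∈ A.erase a, b θ < a θ :=
    ⟨θ, fun b hb => hθ b (hmem b hb).1 (hmem b hb).2⟩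
  exact ⟨fun h => ⟨fun θ => h.lt_of_lt, fun b hb => h.exists_mixture_le hrich hb⟩,
    fun h => bSuperiorMany_of_exists_mixture_le h.1 h.2⟩
end

section
/- In the two-state flexible information acquisition problem, â is selected more than a if and only if â weakly dominates a or â weakly dominates b (i.e., â₀ ≥ a₀ and â₁ ≥ a₁, or â₀ ≥ b₀ and â₁ ≥ b₁). -/
open MeasureTheory

/-- Expected utility of the action paying `x0` in state 0 and `x1` in state 1,
at belief `μ` (the probability of state 1). -/
def expUtil (u : ℝ → ℝ) (x0 x1 μ : ℝ) : ℝ := (1 - μ) * u x0 + μ * u x1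

/-- A UPS cost kernel: continuous and strictly convex on `[0,1]`, twice
continuously differentiable on `(0,1)`. -/
def UPSKernel (c : ℝ → ℝ) : Prop :=
  ContinuousOn c (Set.Icc 0 1) ∧ StrictConvexOn ℝ (Set.Icc 0 1) c ∧
    ContDiffOn ℝ 2 c (Set.Ioo 0 1)

/-- A Bayes-plausible distribution over posteriors in `[0,1]` with prior `μ₀`. -/
def Feasible (μ₀ : ℝ) (F : Measure ℝ) : Prop :=
  IsProbabilityMeasure F ∧ F (Set.Icc (0 : ℝ) 1)ᶜ = 0 ∧ (∫ μ, μ ∂F) = μ₀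

/-- `F` solves the flexible information acquisition problem with value
function `W`, prior `μ₀`, and UPS cost induced by `c`. -/
def OptimalFor (c : ℝ → ℝ) (μ₀ : ℝ) (W : ℝ → ℝ) (F : Measure ℝ) : Prop :=
  Feasible μ₀ F ∧ ∀ F' : Measure ℝ, Feasible μ₀ F' →
    (∫ μ, W μ ∂F) - ((∫ μ, c μ ∂F) - c μ₀) ≥
      (∫ μ, W μ ∂F') - ((∫ μ, c μ ∂F') - c μ₀)

/-- `p` is an optimal choice probability of the action `(x0, x1)` against the
action `(b0, b1)`: some optimal distribution over posteriors together with a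
measurable optimal selection chooses `(x0, x1)` with probability `p`. -/
def OptChoiceProb (c : ℝ → ℝ) (μ₀ : ℝ) (u : ℝ → ℝ) (x0 x1 b0 b1 p : ℝ) : Prop :=
  ∃ F : Measure ℝ,
    OptimalFor c μ₀ (fun μ => max (expUtil u x0 x1 μ) (expUtil u b0 b1 μ)) F ∧
    ∃ σ : ℝ → Bool, Measurable σ ∧
      (∀ μ, σ μ = true → expUtil u x0 x1 μ ≥ expUtil u b0 b1 μ) ∧
      (∀ μ, σ μ = false → expUtil u b0 b1 μ ≥ expUtil u x0 x1 μ) ∧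
      p = (F {μ | σ μ = true}).toReal

/-- `ahat` is selected more than `a` (against `b`): for every UPS cost, interior
prior, and strictly increasing concave continuous utility, every optimal choice
probability of `a` is weakly exceeded by some optimal choice probability of
`ahat`. -/
def SelectedMore (a0 a1 b0 b1 h0 h1 : ℝ) : Prop :=
  ∀ c : ℝ → ℝ, UPSKernel c → ∀ μ₀ ∈ Set.Ioo (0 : ℝ) 1,
    ∀ u : ℝ → ℝ, StrictMono u → ConcaveOn ℝ Set.univ u → Continuous u →
      ∀ p : ℝ, OptChoiceProb c μ₀ u a0 a1 b0 b1 p →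
        ∃ ph : ℝ, OptChoiceProb c μ₀ u h0 h1 b0 b1 ph ∧ ph ≥ p

/-- A continuous function on `[0,1]` has, at an interior point `m`, a dominating affine function
whose value at `m` is attained by averaging the function over two points with mean `m`. -/
theorem exists_affine_majorant_attained {G : ℝ → ℝ} (hG : ContinuousOn G (Set.Icc 0 1)) {m : ℝ}
    (hm : m ∈ Set.Ioo (0 : ℝ) 1) :
    ∃ v s x y t : ℝ, x ∈ Set.Icc (0 : ℝ) 1 ∧ y ∈ Set.Icc (0 : ℝ) 1 ∧ t ∈ Set.Icc (0 : ℝ) 1 ∧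
      (1 - t) * x + t * y = m ∧ (1 - t) * G x + t * G y = v + s * m ∧
      ∀ μ ∈ Set.Icc (0 : ℝ) 1, G μ ≤ v + s * μ := by
  obtain ⟨hm0, hm1⟩ := hm
  let I : Set ℝ := Set.Icc 0 1
  let K : Set (ℝ × ℝ × ℝ) := (I ×ˢ I ×ˢ I) ∩ {q | (1 - q.2.2) * q.1 + q.2.2 * q.2.1 = m}
  have hK : IsCompact K :=
    (isCompact_Icc.prod (isCompact_Icc.prod isCompact_Icc)).inter_right
      (isClosed_eq (by fun_prop) (by fun_prop))
  have hcont : ContinuousOn (fun q : ℝ × ℝ × ℝ => (1 - q.2.2) * G q.1 + q.2.2 * G q.2.1) K := by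
    have h1 : ContinuousOn (fun q : ℝ × ℝ × ℝ => G q.1) K :=
      hG.comp continuous_fst.continuousOn fun q hq => hq.1.1
    have h2 : ContinuousOn (fun q : ℝ × ℝ × ℝ => G q.2.1) K :=
      hG.comp (by fun_prop) fun q hq => hq.1.2.1
    exact (ContinuousOn.mul (by fun_prop) h1).add (ContinuousOn.mul (by fun_prop) h2)
  have hmI : m ∈ I := ⟨hm0.le, hm1.le⟩
  have hmK : (m, m, 0) ∈ K := ⟨⟨hmI, hmI, by simp [I]⟩, by simp⟩
  obtain ⟨⟨x, y, t⟩, ⟨⟨hx, hy, ht⟩, hmean⟩, hmax⟩ := hK.exists_isMaxOn ⟨_, hmK⟩ hcont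
  simp only [Set.mem_ofPred_eq] at hmean hx hy ht
  set v := (1 - t) * G x + t * G y with hv
  have hmaxm : G m ≤ v := by simpa using hmax hmK
  have hbin : ∀ a ∈ Set.Ico 0 m, ∀ b ∈ Set.Ioc m 1,
      (G b - v) / (b - m) ≤ (v - G a) / (m - a) := by
    rintro a ⟨ha0, ha⟩ b ⟨hb, hb1⟩
    have hab : 0 < b - a := by linarith
    have hq : (a, b, (m - a) / (b - a)) ∈ K := by
      refine ⟨⟨⟨ha0, by linarith⟩, ⟨by linarith, hb1⟩, ⟨?_, ?_⟩⟩, ?_⟩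
      · exact div_nonneg (by linarith) hab.le
      · rw [div_le_one hab]; linarith
      · simp only [Set.mem_ofPred_eq]; field_simp; ring
    have h := hmax hq
    simp only [Set.mem_ofPred_eq, ← hv] at h
    have h' : (b - m) * G a + (m - a) * G b ≤ v * (b - a) := by
      have : (1 - (m - a) / (b - a)) * G a + (m - a) / (b - a) * G b
          = ((b - m) * G a + (m - a) * G b) / (b - a) := by field_simp; ring
      rw [this, div_le_iff₀ hab] at h
      exact h
    rw [div_le_div_iff₀ (by linarith) (by linarith)]
    linarith
  let S : Set ℝ := (fun b => (G b - v) / (b - m)) '' Set.Ioc m 1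
  have hS : BddAbove S := ⟨_, by
    rintro _ ⟨b, hb, rfl⟩
    exact hbin 0 ⟨le_rfl, hm0⟩ b hb⟩
  have hSne : S.Nonempty := ⟨_, 1, ⟨hm1, le_rfl⟩, rfl⟩
  refine ⟨v - sSup S * m, sSup S, x, y, t, hx, hy, ht, hmean, by ring, ?_⟩
  rintro μ ⟨hμ0, hμ1⟩
  rcases lt_trichotomy μ m with h | rfl | h
  · have : sSup S ≤ (v - G μ) / (m - μ) := csSup_le hSne (by
      rintro _ ⟨b, hb, rfl⟩
      exact hbin μ ⟨hμ0, h⟩ b hb)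
    rw [le_div_iff₀ (by linarith)] at this
    linarith
  · linarith
  · have : (G μ - v) / (μ - m) ≤ sSup S := le_csSup hS ⟨μ, ⟨h, hμ1⟩, rfl⟩
    rw [div_le_iff₀ (by linarith)] at this
    linarith

theorem Feasible.ae_mem {m : ℝ} {F : Measure ℝ} (hF : Feasible m F) :
    ∀ᵐ μ ∂F, μ ∈ Set.Icc (0 : ℝ) 1 :=
  hF.2.1

theorem Feasible.integrable {m : ℝ} {F : Measure ℝ} (hF : Feasible m F) {f : ℝ → ℝ}
    (hf : ContinuousOn f (Set.Icc 0 1)) : Integrable f F := by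
  have := hF.1
  rw [← Measure.restrict_eq_self_of_ae_mem hF.ae_mem]
  exact hf.integrableOn_compact isCompact_Icc

theorem Feasible.integral_affine {m : ℝ} {F : Measure ℝ} (hF : Feasible m F) (v s : ℝ) :
    ∫ μ, (v + s * μ) ∂F = v + s * m := by
  have := hF.1
  rw [integral_add (integrable_const _) (hF.integrable (by fun_prop)), integral_const_mul, hF.2.2]
  simp

theorem Feasible.integral_le_affine {m : ℝ} {F : Measure ℝ} (hF : Feasible m F) {G : ℝ → ℝ}
    (hG : ContinuousOn G (Set.Icc 0 1)) {v s : ℝ}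
    (h : ∀ μ ∈ Set.Icc (0 : ℝ) 1, G μ ≤ v + s * μ) : ∫ μ, G μ ∂F ≤ v + s * m := by
  rw [← hF.integral_affine]
  refine integral_mono_ae (hF.integrable hG) (hF.integrable (by fun_prop)) ?_
  filter_upwards [hF.ae_mem] with μ hμ using h μ hμ

theorem Feasible.ae_eq_affine {m : ℝ} {F : Measure ℝ} (hF : Feasible m F) {G : ℝ → ℝ}
    (hG : ContinuousOn G (Set.Icc 0 1)) {v s : ℝ}
    (h : ∀ μ ∈ Set.Icc (0 : ℝ) 1, G μ ≤ v + s * μ) (hle : v + s * m ≤ ∫ μ, G μ ∂F) :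
    ∀ᵐ μ ∂F, G μ = v + s * μ := by
  have hL : Integrable (fun μ : ℝ => v + s * μ) F := hF.integrable (by fun_prop)
  have h0 : 0 ≤ᵐ[F] fun μ => v + s * μ - G μ := by
    filter_upwards [hF.ae_mem] with μ hμ using sub_nonneg.2 (h μ hμ)
  have hint : ∫ μ, (v + s * μ - G μ) ∂F = 0 := by
    refine le_antisymm ?_ (integral_nonneg_of_ae h0)
    rw [integral_sub hL (hF.integrable hG), hF.integral_affine]
    linarith
  filter_upwards [(integral_eq_zero_iff_of_nonneg_ae h0 (hL.sub (hF.integrable hG))).1 hint]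
    with μ hμ
  exact (sub_eq_zero.1 hμ).symm

theorem feasible_dirac {m : ℝ} (hm : m ∈ Set.Icc (0 : ℝ) 1) : Feasible m (Measure.dirac m) := by
  refine ⟨inferInstance, ?_, by simp⟩
  rw [Measure.dirac_apply' _ measurableSet_Icc.compl]
  simpa using hm

theorem exists_feasible_binary {x y t : ℝ} (hx : x ∈ Set.Icc (0 : ℝ) 1)
    (hy : y ∈ Set.Icc (0 : ℝ) 1) (ht : t ∈ Set.Icc (0 : ℝ) 1) :
    ∃ F, Feasible ((1 - t) * x + t * y) F ∧
      ∀ f : ℝ → ℝ, ∫ μ, f μ ∂F = (1 - t) * f x + t * f y := by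
  have h1 : 0 ≤ 1 - t := sub_nonneg.2 ht.2
  let F : Measure ℝ :=
    ENNReal.ofReal (1 - t) • Measure.dirac x + ENNReal.ofReal t • Measure.dirac y
  have hint : ∀ f : ℝ → ℝ, ∫ μ, f μ ∂F = (1 - t) * f x + t * f y := fun f => by
    have hd : ∀ z : ℝ, Integrable f (Measure.dirac z) := fun z =>
      integrable_dirac (by simp)
    rw [integral_add_measure ((hd x).smul_measure (by simp)) ((hd y).smul_measure (by simp)),
      integral_smul_measure, integral_smul_measure, integral_dirac, integral_dirac,
      ENNReal.toReal_ofReal h1, ENNReal.toReal_ofReal ht.1]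
    rfl
  refine ⟨F, ⟨⟨?_⟩, ?_, hint _⟩, hint⟩
  · simp [F, ← ENNReal.ofReal_add h1 ht.1]
  · simp only [F, Measure.add_apply, Measure.smul_apply,
      Measure.dirac_apply' _ measurableSet_Icc.compl]
    simp [hx.1, hx.2, hy.1, hy.2]

section Duality

variable {c W : ℝ → ℝ} {m : ℝ} {F : Measure ℝ}

theorem Feasible.payoff_eq (hF : Feasible m F) (hc : ContinuousOn c (Set.Icc 0 1))
    (hW : ContinuousOn W (Set.Icc 0 1)) :
    (∫ μ, W μ ∂F) - ((∫ μ, c μ ∂F) - c m) = (∫ μ, (W μ - c μ) ∂F) + c m := by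
  rw [integral_sub (hF.integrable hW) (hF.integrable hc)]
  ring

theorem exists_optimalFor (hc : ContinuousOn c (Set.Icc 0 1)) (hW : ContinuousOn W (Set.Icc 0 1))
    (hm : m ∈ Set.Ioo (0 : ℝ) 1) : ∃ F, OptimalFor c m W F := by
  obtain ⟨v, s, x, y, t, hx, hy, ht, rfl, hval, hle⟩ :=
    exists_affine_majorant_attained (hW.sub hc) hm
  obtain ⟨F, hF, hint⟩ := exists_feasible_binary hx hy ht
  refine ⟨F, hF, fun F' hF' => ?_⟩
  rw [hF.payoff_eq hc hW, hF'.payoff_eq hc hW, hint]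
  have := hF'.integral_le_affine (hW.sub hc) hle
  simp only [Pi.sub_apply] at this hval
  linarith

theorem OptimalFor.exists_affine (hF : OptimalFor c m W F) (hc : ContinuousOn c (Set.Icc 0 1))
    (hW : ContinuousOn W (Set.Icc 0 1)) (hm : m ∈ Set.Ioo (0 : ℝ) 1) :
    ∃ v s : ℝ, (∀ μ ∈ Set.Icc (0 : ℝ) 1, W μ - c μ ≤ v + s * μ) ∧
      ∀ᵐ μ ∂F, W μ - c μ = v + s * μ := by
  obtain ⟨v, s, x, y, t, hx, hy, ht, rfl, hval, hle⟩ :=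
    exists_affine_majorant_attained (hW.sub hc) hm
  obtain ⟨F', hF', hint⟩ := exists_feasible_binary hx hy ht
  refine ⟨v, s, hle, hF.1.ae_eq_affine (hW.sub hc) hle ?_⟩
  have h := hF.2 F' hF'
  rw [hF.1.payoff_eq hc hW, hF'.payoff_eq hc hW, hint] at h
  simp only [Pi.sub_apply] at hval ⊢
  linarith

end Duality

/-- An affine function dominating `A - c`, with `A` affine and `c` strictly convex, touches it at
most once. -/
theorem StrictConvexOn.contact_unique {c : ℝ → ℝ} (hc : StrictConvexOn ℝ (Set.Icc 0 1) c)
    {A₀ A₁ v s : ℝ} (hle : ∀ μ ∈ Set.Icc (0 : ℝ) 1, (1 - μ) * A₀ + μ * A₁ - c μ ≤ v + s * μ)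
    {x z : ℝ} (hx : x ∈ Set.Icc (0 : ℝ) 1) (hz : z ∈ Set.Icc (0 : ℝ) 1)
    (hxe : (1 - x) * A₀ + x * A₁ - c x = v + s * x)
    (hze : (1 - z) * A₀ + z * A₁ - c z = v + s * z) : x = z := by
  by_contra hne
  have h := hc.2 hx hz hne one_half_pos one_half_pos (add_halves 1)
  simp only [smul_eq_mul] at h
  have h' := hle (1 / 2 * x + 1 / 2 * z)
    ⟨by linarith [hx.1, hz.1], by linarith [hx.2, hz.2]⟩
  linarith

/-- The action `A` is taken with probability `p` at posterior `x`, and `B` otherwise at posterior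
`y`; both posteriors are contact points of the affine function `v + s * μ`, which certifies
optimality. -/
structure IsBinarySolution (c : ℝ → ℝ) (m A₀ A₁ B₀ B₁ p x y v s : ℝ) : Prop where
  nonneg : 0 ≤ p
  le_one : p ≤ 1
  left_mem : x ∈ Set.Icc (0 : ℝ) 1
  right_mem : y ∈ Set.Icc (0 : ℝ) 1
  mean : p * x + (1 - p) * y = m
  left_le : ∀ μ ∈ Set.Icc (0 : ℝ) 1, (1 - μ) * A₀ + μ * A₁ - c μ ≤ v + s * μ
  right_le : ∀ μ ∈ Set.Icc (0 : ℝ) 1, (1 - μ) * B₀ + μ * B₁ - c μ ≤ v + s * μ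
  left_eq : 0 < p → (1 - x) * A₀ + x * A₁ - c x = v + s * x
  right_eq : p < 1 → (1 - y) * B₀ + y * B₁ - c y = v + s * y

theorem IsBinarySolution.left_le_mean {c : ℝ → ℝ} {m A₀ A₁ B₀ B₁ p x y v s : ℝ}
    (h : IsBinarySolution c m A₀ A₁ B₀ B₁ p x y v s) (h0 : B₀ < A₀) (h1 : A₁ < B₁)
    (hp : 0 < p) : x ≤ m := by
  rcases h.le_one.lt_or_eq with hp1 | rfl
  · have hx := h.left_eq hp
    have hy := h.right_eq hp1
    have hx' := h.right_le x h.left_mem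
    have hy' := h.left_le y h.right_mem
    have hxy : x ≤ y := by
      by_contra! hlt
      nlinarith [mul_pos (sub_pos.2 hlt) (sub_pos.2 h0), mul_pos (sub_pos.2 hlt) (sub_pos.2 h1)]
    rw [← h.mean]
    nlinarith
  · linarith [h.mean]

theorem IsBinarySolution.mean_le_right {c : ℝ → ℝ} {m A₀ A₁ B₀ B₁ p x y v s : ℝ}
    (h : IsBinarySolution c m A₀ A₁ B₀ B₁ p x y v s) (h0 : B₀ < A₀) (h1 : A₁ < B₁)
    (hp : p < 1) : m ≤ y := by
  rcases h.nonneg.lt_or_eq with hp0 | rfl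
  · have := h.left_le_mean h0 h1 hp0
    have := h.mean
    nlinarith
  · linarith [h.mean]

/-- An affine function that is nonpositive at `x`, nonnegative at `z > x`, and nonnegative at `w`,
either vanishes identically or satisfies `x ≤ w`. -/
theorem eq_zero_or_le_of_affine {e f x z w : ℝ} (hxz : x < z) (hx : e + f * x ≤ 0)
    (hz : 0 ≤ e + f * z) (hw : 0 ≤ e + f * w) : (e = 0 ∧ f = 0) ∨ x ≤ w := by
  have hf : 0 ≤ f := by
    by_contra! hf
    nlinarith
  rcases hf.lt_or_eq with hf | rfl
  · right
    by_contra! h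
    nlinarith
  · left
    exact ⟨by linarith, rfl⟩

/-- Improving `A` in some state, without making it dominate `B`, raises its probability. -/
theorem IsBinarySolution.prob_mono {c : ℝ → ℝ} (hc : StrictConvexOn ℝ (Set.Icc 0 1) c)
    {m A₀ A₁ H₀ H₁ B₀ B₁ p x y v s p' x' y' v' s' : ℝ} (hm : m ∈ Set.Ioo (0 : ℝ) 1)
    (h : IsBinarySolution c m A₀ A₁ B₀ B₁ p x y v s)
    (h' : IsBinarySolution c m H₀ H₁ B₀ B₁ p' x' y' v' s')
    (hA0 : B₀ < A₀) (hA1 : A₁ < B₁) (hH0 : A₀ ≤ H₀) (hH1 : A₁ ≤ H₁) (hHB : H₁ < B₁)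
    (hne : A₀ < H₀ ∨ A₁ < H₁) : p ≤ p' := by
  by_contra! hpp
  obtain ⟨hm0, hm1⟩ := hm
  have hp : 0 < p := h'.nonneg.trans_lt hpp
  have hp' : p' < 1 := hpp.trans_le h.le_one
  have hxm := h.left_le_mean hA0 hA1 hp
  have hmy := h'.mean_le_right (hA0.trans_le hH0) hHB hp'
  have hmean := h.mean
  have hmean' := h'.mean
  have hδ0 : ∀ μ ∈ Set.Icc (0 : ℝ) 1, 0 ≤ (1 - μ) * (H₀ - A₀) + μ * (H₁ - A₁) := fun μ hμ =>
    add_nonneg (mul_nonneg (by linarith [hμ.2]) (by linarith))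
      (mul_nonneg hμ.1 (by linarith))
  have hδ : ∀ μ ∈ Set.Ioo (0 : ℝ) 1, 0 < (1 - μ) * (H₀ - A₀) + μ * (H₁ - A₁) := by
    rintro μ ⟨hμ0, hμ1⟩
    rcases hne with h | h
    · exact add_pos_of_pos_of_nonneg (mul_pos (by linarith) (by linarith))
        (mul_nonneg hμ0.le (by linarith))
    · exact add_pos_of_nonneg_of_pos (mul_nonneg (by linarith) (by linarith))
        (mul_pos hμ0 (by linarith))
  -- with `D = (v' + s' * μ) - (v + s * μ)` and `E = (H - A) - D`
  have hEx : (H₀ - A₀ - (v' - v)) + ((H₁ - A₁) - (H₀ - A₀) - (s' - s)) * x ≤ 0 := by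
    linarith [h.left_eq hp, h'.left_le x h.left_mem]
  have hDy' : (v' - v) + (s' - s) * y' ≤ 0 := by
    linarith [h'.right_eq hp', h.right_le y' h'.right_mem]
  have hDy : p < 1 → 0 ≤ (v' - v) + (s' - s) * y := fun hp1 => by
    linarith [h.right_eq hp1, h'.right_le y h.right_mem]
  have hEx' : 0 < p' →
      0 ≤ (H₀ - A₀ - (v' - v)) + ((H₁ - A₁) - (H₀ - A₀) - (s' - s)) * x' := fun hp0 => by
    linarith [h'.left_eq hp0, h.left_le x' h'.left_mem]
  have hDx : 0 ≤ (v' - v) + (s' - s) * x := by linarith [hδ0 x h.left_mem]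
  have hEy' : 0 ≤ (H₀ - A₀ - (v' - v)) + ((H₁ - A₁) - (H₀ - A₀) - (s' - s)) * y' := by
    linarith [hδ0 y' h'.right_mem]
  -- contact points coincide when the dominating functions do
  have hcx : 0 < p' → H₀ - A₀ - (v' - v) = 0 → (H₁ - A₁) - (H₀ - A₀) - (s' - s) = 0 →
      x = x' := fun hp0 e f => by
    refine hc.contact_unique h.left_le h.left_mem h'.left_mem (h.left_eq hp) ?_
    have := h'.left_eq hp0
    obtain rfl : v' = H₀ - A₀ + v := by linarith
    obtain rfl : s' = (H₁ - A₁) - (H₀ - A₀) + s := by linarith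
    linarith
  have hcy : p < 1 → v' - v = 0 → s' - s = 0 → y = y' := fun hp1 e f => by
    refine hc.contact_unique h.right_le h.right_mem h'.right_mem (h.right_eq hp1) ?_
    have := h'.right_eq hp'
    obtain rfl : v' = v := by linarith
    obtain rfl : s' = s := by linarith
    linarith
  have hEm : (1 - p') * ((1 - y') * (H₀ - A₀) + y' * (H₁ - A₁)) ≤
      (H₀ - A₀ - (v' - v)) + ((H₁ - A₁) - (H₀ - A₀) - (s' - s)) * m := by
    have h1 : 0 ≤ p' *
        ((H₀ - A₀ - (v' - v)) + ((H₁ - A₁) - (H₀ - A₀) - (s' - s)) * x') := by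
      rcases h'.nonneg.lt_or_eq with h0 | h0
      · exact mul_nonneg h0.le (hEx' h0)
      · simp [← h0]
    have h2 := mul_nonpos_of_nonneg_of_nonpos (sub_pos.2 hp').le hDy'
    rw [← hmean']
    linarith
  have hDm : p * ((1 - x) * (H₀ - A₀) + x * (H₁ - A₁)) ≤ (v' - v) + (s' - s) * m := by
    have h1 : 0 ≤ (1 - p) * ((v' - v) + (s' - s) * y) := by
      rcases h.le_one.lt_or_eq with h0 | h0
      · exact mul_nonneg (sub_pos.2 h0).le (hDy h0)
      · simp [h0]
    have h2 := mul_nonpos_of_nonneg_of_nonpos hp.le hEx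
    rw [← hmean]
    linarith
  rcases hxm.lt_or_eq with hxm | rfl
  · rcases hmy.lt_or_eq with hmy | rfl
    · have hp1 : p < 1 := h.le_one.lt_of_ne (by rintro rfl; linarith)
      have hp0 : 0 < p' := h'.nonneg.lt_of_ne (by rintro rfl; linarith)
      have hxx : x ≤ x' := by
        rcases eq_zero_or_le_of_affine (hxm.trans hmy) hEx hEy' (hEx' hp0) with ⟨e, f⟩ | h
        · exact (hcx hp0 e f).le
        · exact h
      have hyy : y ≤ y' := by
        have := eq_zero_or_le_of_affine (e := (v' - v) + (s' - s)) (f := -(s' - s))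
          (x := 1 - y') (z := 1 - x) (w := 1 - y) (by linarith) (by linarith) (by linarith)
          (by linarith [hDy hp1])
        rcases this with ⟨e, f⟩ | h
        · exact (hcy hp1 (by linarith) (by linarith)).le
        · linarith
      have hxy : x < y := by
        by_contra! hyx
        nlinarith
      nlinarith [mul_pos (sub_pos.2 hpp) (sub_pos.2 hxy),
        mul_nonneg hp0.le (sub_nonneg.2 hxx), mul_nonneg (sub_pos.2 hp').le (sub_nonneg.2 hyy)]
    · have hδx : (1 - x) * (H₀ - A₀) + x * (H₁ - A₁) ≤ 0 := by
        by_contra! hlt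
        linarith [mul_pos hp hlt]
      have hx0 : x = 0 := by
        by_contra hx0
        have := hδ x ⟨h.left_mem.1.lt_of_ne' hx0, by linarith⟩
        linarith
      have hDx0 : (v' - v) + (s' - s) * x = 0 := by
        refine le_antisymm ?_ hDx
        have h1 : 0 ≤ (1 - p) * ((v' - v) + (s' - s) * y) := by
          rcases h.le_one.lt_or_eq with h0 | h0
          · exact mul_nonneg (sub_pos.2 h0).le (hDy h0)
          · simp [h0]
        rw [← hmean] at hDy'
        by_contra! hlt
        linarith [mul_pos hp hlt]
      have hp1 : p < 1 := h.le_one.lt_of_ne (by rintro rfl; linarith)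
      subst hx0
      have hDm0 := hδ0 0 (by simp)
      have hv : v' - v = 0 := by linarith
      have hs : s' - s = 0 := by
        have : (s' - s) * m = 0 := by
          have := mul_nonneg hp.le hDm0
          linarith
        exact (mul_eq_zero.1 this).resolve_right hm0.ne'
      have := hcy hp1 hv hs
      subst this
      nlinarith
  · have hδy : (1 - y') * (H₀ - A₀) + y' * (H₁ - A₁) ≤ 0 := by
      by_contra! hlt
      linarith [mul_pos (sub_pos.2 hp') hlt]
    have hy1 : y' = 1 := by
      by_contra hy1
      have := hδ y' ⟨by linarith, h'.right_mem.2.lt_of_ne hy1⟩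
      linarith
    have hp0 : 0 < p' := h'.nonneg.lt_of_ne (by rintro rfl; linarith)
    have hEy0 : (H₀ - A₀ - (v' - v)) + ((H₁ - A₁) - (H₀ - A₀) - (s' - s)) * y' = 0 := by
      refine le_antisymm ?_ hEy'
      have h1 := mul_nonneg hp0.le (hEx' hp0)
      have h2 := hEx
      rw [← hmean'] at h2
      by_contra! hlt
      linarith [mul_pos (sub_pos.2 hp') hlt]
    have hE0 : (H₀ - A₀ - (v' - v)) + ((H₁ - A₁) - (H₀ - A₀) - (s' - s)) * x = 0 := by
      refine le_antisymm hEx (le_trans ?_ hEm)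
      exact mul_nonneg (sub_pos.2 hp').le (hδ0 y' h'.right_mem)
    have hf : (H₁ - A₁) - (H₀ - A₀) - (s' - s) = 0 := by
      have : ((H₁ - A₁) - (H₀ - A₀) - (s' - s)) * (y' - x) = 0 := by linarith
      exact (mul_eq_zero.1 this).resolve_right (by linarith)
    have he : H₀ - A₀ - (v' - v) = 0 := by rw [hf] at hE0; linarith
    have := hcx hp0 he hf
    subst this hy1
    nlinarith

@[fun_prop]
theorem continuous_expUtil (u : ℝ → ℝ) (x0 x1 : ℝ) : Continuous (expUtil u x0 x1) := by
  unfold expUtil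
  fun_prop

theorem measurable_decide_le {f g : ℝ → ℝ} (hf : Measurable f) (hg : Measurable g) :
    Measurable fun μ => decide (f μ ≤ g μ) :=
  measurable_to_bool (by simpa [Set.preimage] using measurableSet_le hf hg)

theorem exists_optChoiceProb {c : ℝ → ℝ} (hc : ContinuousOn c (Set.Icc 0 1)) {m : ℝ}
    (hm : m ∈ Set.Ioo (0 : ℝ) 1) (u : ℝ → ℝ) (x0 x1 b0 b1 : ℝ) :
    ∃ p, OptChoiceProb c m u x0 x1 b0 b1 p := by
  obtain ⟨F, hF⟩ := exists_optimalFor (m := m)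
    (W := fun μ => max (expUtil u x0 x1 μ) (expUtil u b0 b1 μ)) hc (by fun_prop) hm
  refine ⟨_, F, hF, fun μ => decide (expUtil u b0 b1 μ ≤ expUtil u x0 x1 μ), ?_, ?_, ?_, rfl⟩
  · exact measurable_decide_le (by fun_prop) (by fun_prop)
  · intro μ h
    simpa using h
  · intro μ h
    exact (not_le.1 (by simpa using h)).le

theorem OptChoiceProb.exists_isBinarySolution {c : ℝ → ℝ} {m : ℝ} {u : ℝ → ℝ}
    {x0 x1 b0 b1 p : ℝ} (h : OptChoiceProb c m u x0 x1 b0 b1 p)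
    (hc : ContinuousOn c (Set.Icc 0 1)) (hcs : StrictConvexOn ℝ (Set.Icc 0 1) c)
    (hm : m ∈ Set.Ioo (0 : ℝ) 1) :
    ∃ x y v s, IsBinarySolution c m (u x0) (u x1) (u b0) (u b1) p x y v s := by
  obtain ⟨F, hF, σ, hσ, hσt, hσf, rfl⟩ := h
  have := hF.1.1
  obtain ⟨v, s, hle, hae⟩ := hF.exists_affine hc (by fun_prop) hm
  have hle1 : ∀ μ ∈ Set.Icc (0 : ℝ) 1, (1 - μ) * u x0 + μ * u x1 - c μ ≤ v + s * μ :=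
    fun μ hμ => (sub_le_sub_right (le_max_left _ _) _).trans (hle μ hμ)
  have hle2 : ∀ μ ∈ Set.Icc (0 : ℝ) 1, (1 - μ) * u b0 + μ * u b1 - c μ ≤ v + s * μ :=
    fun μ hμ => (sub_le_sub_right (le_max_right _ _) _).trans (hle μ hμ)
  have hms : MeasurableSet {μ | σ μ = true} := hσ (measurableSet_singleton true)
  have hT : ∀ᵐ μ ∂F, σ μ = true →
      μ ∈ Set.Icc (0 : ℝ) 1 ∧ (1 - μ) * u x0 + μ * u x1 - c μ = v + s * μ := by
    filter_upwards [hae, hF.1.ae_mem] with μ h hμ hσμ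
    rw [max_eq_left (hσt μ hσμ)] at h
    exact ⟨hμ, h⟩
  have hf : ∀ᵐ μ ∂F, σ μ ≠ true →
      μ ∈ Set.Icc (0 : ℝ) 1 ∧ (1 - μ) * u b0 + μ * u b1 - c μ = v + s * μ := by
    filter_upwards [hae, hF.1.ae_mem] with μ h hμ hσμ
    rw [max_eq_right (hσf μ (by simpa using hσμ))] at h
    exact ⟨hμ, h⟩
  obtain ⟨x, hx, hxe, hxu⟩ : ∃ x ∈ Set.Icc (0 : ℝ) 1,
      (0 < F.real {μ | σ μ = true} → (1 - x) * u x0 + x * u x1 - c x = v + s * x) ∧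
      ∀ᵐ μ ∂F, σ μ = true → μ = x := by
    by_cases h0 : F.real {μ | σ μ = true} = 0
    · refine ⟨0, by simp, fun h => absurd h0 h.ne', ?_⟩
      have : F {μ | σ μ = true} = 0 := by rwa [measureReal_eq_zero_iff] at h0
      filter_upwards [measure_eq_zero_iff_ae_notMem.1 this] with μ h h'
      exact absurd h' h
    · obtain ⟨x, hσx, hx⟩ := (Filter.Frequently.and_eventually
        (frequently_ae_iff.2 fun h => h0 (by
          rw [Measure.real, ENNReal.toReal_eq_zero_iff]; exact Or.inl h)) hT).exists
      refine ⟨x, (hx hσx).1, fun _ => (hx hσx).2, ?_⟩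
      filter_upwards [hT] with μ hμ hσμ
      exact hcs.contact_unique hle1 (hμ hσμ).1 (hx hσx).1 (hμ hσμ).2 (hx hσx).2
  obtain ⟨y, hy, hye, hyu⟩ : ∃ y ∈ Set.Icc (0 : ℝ) 1,
      (F.real {μ | σ μ = true} < 1 → (1 - y) * u b0 + y * u b1 - c y = v + s * y) ∧
      ∀ᵐ μ ∂F, σ μ ≠ true → μ = y := by
    by_cases h0 : F.real {μ | σ μ = true}ᶜ = 0
    · refine ⟨0, by simp, fun h => ?_, ?_⟩
      · rw [probReal_compl_eq_one_sub hms] at h0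
        linarith
      have : F {μ | σ μ = true}ᶜ = 0 := by rwa [measureReal_eq_zero_iff] at h0
      filter_upwards [measure_eq_zero_iff_ae_notMem.1 this] with μ h h'
      exact absurd h' h
    · obtain ⟨y, hσy, hy⟩ := (Filter.Frequently.and_eventually
        (frequently_ae_iff.2 fun h => h0 (by
          rw [Measure.real, ENNReal.toReal_eq_zero_iff]; exact Or.inl h)) hf).exists
      refine ⟨y, (hy hσy).1, fun _ => (hy hσy).2, ?_⟩
      filter_upwards [hf] with μ hμ hσμ
      exact hcs.contact_unique hle2 (hμ hσμ).1 (hy hσy).1 (hμ hσμ).2 (hy hσy).2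
  refine ⟨x, y, v, s, measureReal_nonneg, measureReal_le_one, hx, hy, ?_, hle1, hle2, hxe, hye⟩
  have hid : (fun μ => μ) =ᵐ[F] fun μ => y + {μ | σ μ = true}.indicator (fun _ => x - y) μ := by
    filter_upwards [hxu, hyu] with μ h1 h2
    by_cases h : σ μ = true
    · simpa [h] using h1 h
    · simpa [h] using h2 h
  have hmean : ∫ μ, μ ∂F = m := hF.1.2.2
  rw [integral_congr_ae hid, integral_add (integrable_const _)
    ((integrable_const _).indicator hms), integral_indicator_const _ hms] at hmean
  simp only [integral_const, probReal_univ, smul_eq_mul, one_mul] at hmean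
  rw [← hmean, Measure.real]
  ring

theorem OptChoiceProb.le_one {c : ℝ → ℝ} {m : ℝ} {u : ℝ → ℝ} {x0 x1 b0 b1 p : ℝ}
    (h : OptChoiceProb c m u x0 x1 b0 b1 p) : p ≤ 1 := by
  obtain ⟨F, hF, σ, -, -, -, rfl⟩ := h
  have := hF.1.1
  exact measureReal_le_one

theorem optChoiceProb_one_of_dominates {c : ℝ → ℝ} (hc : UPSKernel c) {m : ℝ}
    (hm : m ∈ Set.Ioo (0 : ℝ) 1) {u : ℝ → ℝ} (hu : Monotone u) {h0 h1 b0 b1 : ℝ}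
    (hb0 : b0 ≤ h0) (hb1 : b1 ≤ h1) : OptChoiceProb c m u h0 h1 b0 b1 1 := by
  have hdom : ∀ μ ∈ Set.Icc (0 : ℝ) 1, expUtil u b0 b1 μ ≤ expUtil u h0 h1 μ := fun μ hμ =>
    add_le_add (mul_le_mul_of_nonneg_left (hu hb0) (sub_nonneg.2 hμ.2))
      (mul_le_mul_of_nonneg_left (hu hb1) hμ.1)
  have hmI : m ∈ Set.Icc (0 : ℝ) 1 := ⟨hm.1.le, hm.2.le⟩
  refine ⟨Measure.dirac m, ⟨feasible_dirac hmI, fun F hF => ?_⟩,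
    fun μ => decide (expUtil u b0 b1 μ ≤ expUtil u h0 h1 μ), ?_, ?_, ?_, ?_⟩
  · have := hF.1
    have hJ : c m ≤ ∫ μ, c μ ∂F := by
      have := hc.2.1.convexOn.map_integral_le hc.1 isClosed_Icc hF.ae_mem
        (hF.integrable continuousOn_id) (hF.integrable hc.1)
      simpa [hF.2.2] using this
    have hW : ∫ μ, max (expUtil u h0 h1 μ) (expUtil u b0 b1 μ) ∂F ≤
        u h0 + (u h1 - u h0) * m := by
      refine hF.integral_le_affine (by fun_prop) fun μ hμ => ?_
      rw [max_eq_left (hdom μ hμ), expUtil]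
      linarith
    rw [integral_dirac, integral_dirac, max_eq_left (hdom m hmI), expUtil]
    linarith
  · exact measurable_decide_le (by fun_prop) (by fun_prop)
  · intro μ h
    simpa using h
  · intro μ h
    exact (not_le.1 (by simpa using h)).le
  · rw [Measure.dirac_apply_of_mem (by simpa using hdom m hmI)]
    simp

/-- If at some prior `m` the action `h` is never worth learning about, while `a` is, then `h` is
not selected more than `a`. The cost kernel `c` is normalized to have zero value and slope
at `m`. -/
theorem not_selectedMore_of_kernel {a0 a1 b0 b1 h0 h1 : ℝ} {c : ℝ → ℝ} (hc : UPSKernel c) {m : ℝ}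
    (hm : m ∈ Set.Ioo (0 : ℝ) 1) {u : ℝ → ℝ} (hu : StrictMono u) (hu' : ConcaveOn ℝ Set.univ u)
    (hu'' : Continuous u) (hcm : c m = 0) (hdc : HasDerivAt c 0 m)
    (hc0 : ∀ μ ∈ Set.Icc (0 : ℝ) 1, 0 ≤ c μ)
    (hh : ∀ μ ∈ Set.Icc (0 : ℝ) 1, expUtil u h0 h1 μ < expUtil u b0 b1 μ + c μ)
    {x : ℝ} (hx : x ∈ Set.Icc (0 : ℝ) 1) (ha : expUtil u b0 b1 x + c x < expUtil u a0 a1 x) :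
    ¬ SelectedMore a0 a1 b0 b1 h0 h1 := by
  intro hsel
  have hmI : m ∈ Set.Icc (0 : ℝ) 1 := ⟨hm.1.le, hm.2.le⟩
  obtain ⟨p, hp⟩ := exists_optChoiceProb hc.1 hm u a0 a1 b0 b1
  have hp0 : 0 < p := by
    obtain ⟨y, z, v, s, h⟩ := hp.exists_isBinarySolution hc.1 hc.2.1 hm
    refine h.nonneg.lt_of_ne fun hp => ?_
    subst hp
    have hz : z = m := by linarith [h.mean]
    subst hz
    have hz := h.right_eq one_pos
    have hmin : IsLocalMin (fun μ => v + s * μ - ((1 - μ) * u b0 + μ * u b1) + c μ) z := by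
      filter_upwards [Icc_mem_nhds hm.1 hm.2] with μ hμ
      linarith [h.right_le μ hμ]
    have hder : HasDerivAt (fun μ => v + s * μ - ((1 - μ) * u b0 + μ * u b1) + c μ)
        (s - (u b1 - u b0)) z := by
      have h1 : HasDerivAt (fun μ : ℝ => (v - u b0) + (s - (u b1 - u b0)) * μ + c μ)
          (s - (u b1 - u b0)) z := by
        refine ((((hasDerivAt_id z).const_mul _).const_add _).add hdc).congr_deriv ?_
        ring
      convert h1 using 1
      ext μ
      ring
    have hs := hmin.hasDerivAt_eq_zero hder
    obtain rfl : s = u b1 - u b0 := by linarith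
    have := h.left_le x hx
    unfold expUtil at ha
    linarith
  obtain ⟨ph, ⟨F, hF, σ, hσ, hσt, hσf, hph⟩, hge⟩ := hsel c hc m hm u hu hu' hu'' p hp
  have hVc : ∀ μ ∈ Set.Icc (0 : ℝ) 1, max (expUtil u h0 h1 μ) (expUtil u b0 b1 μ) - c μ ≤
      u b0 + (u b1 - u b0) * μ := fun μ hμ => by
    have h1 := hh μ hμ
    have h2 := hc0 μ hμ
    have h3 : expUtil u b0 b1 μ = u b0 + (u b1 - u b0) * μ := by unfold expUtil; ring
    rw [sub_le_iff_le_add, ← h3]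
    exact max_le h1.le (by linarith)
  have hae := hF.1.ae_eq_affine (ContinuousOn.sub (by fun_prop) hc.1) hVc (by
    have h := hF.2 _ (feasible_dirac hmI)
    rw [hF.1.payoff_eq hc.1 (by fun_prop), integral_dirac, integral_dirac, hcm] at h
    have h3 : expUtil u b0 b1 m = u b0 + (u b1 - u b0) * m := by unfold expUtil; ring
    have h4 := le_max_right (expUtil u h0 h1 m) (expUtil u b0 b1 m)
    simp only [Pi.sub_apply]
    linarith)
  simp only [Pi.sub_apply] at hae
  have hnull : F {μ | σ μ = true} = 0 := by
    rw [measure_eq_zero_iff_ae_notMem]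
    filter_upwards [hae, hF.1.ae_mem] with μ h hμ hσμ
    rw [max_eq_left (hσt μ hσμ)] at h
    have h3 : expUtil u b0 b1 μ = u b0 + (u b1 - u b0) * μ := by unfold expUtil; ring
    linarith [hh μ hμ]
  rw [hnull] at hph
  simp at hph
  linarith

theorem upsKernel_sq {K : ℝ} (hK : 0 < K) (m : ℝ) : UPSKernel fun μ => K * (μ - m) ^ 2 := by
  refine ⟨by fun_prop, ⟨convex_Icc 0 1, fun x _ y _ hxy a b ha hb hab => ?_⟩, by fun_prop⟩
  obtain rfl : b = 1 - a := by linarith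
  have := mul_pos (mul_pos (mul_pos ha hb) hK) (sq_pos_of_ne_zero (sub_ne_zero.2 hxy))
  simp only [smul_eq_mul]
  nlinarith

theorem hasDerivAt_sq (K m : ℝ) : HasDerivAt (fun μ => K * (μ - m) ^ 2) 0 m := by
  simpa using ((((hasDerivAt_id m).sub_const m).pow 2).const_mul K)

/-- Up to normalization, the cost `μ ^ n` for large `n`: nearly affine on `[0, m]` with `m` close
to `1`. -/
theorem exists_kernel_nearly_affine {θ : ℝ} (hθ : 1 < θ) {K : ℝ} (hK : 0 < K) :
    ∃ m ∈ Set.Ioo (0 : ℝ) 1, ∃ c, UPSKernel c ∧ c m = 0 ∧ HasDerivAt c 0 m ∧ c 0 = K ∧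
      ∀ μ ∈ Set.Icc (0 : ℝ) 1, 0 ≤ c μ ∧ K * (1 - θ * μ) ≤ c μ := by
  obtain ⟨m, hm1, hm2⟩ := exists_between (inv_lt_one_of_one_lt₀ hθ)
  have hm0 : 0 < m := (inv_pos.2 (by linarith)).trans hm1
  have hθm : 1 < θ * m := by rwa [inv_lt_iff_one_lt_mul₀' (by linarith)] at hm1
  obtain ⟨k, hk⟩ := exists_nat_gt (1 / (θ * m - 1))
  have hk0 : (0 : ℝ) < k := (one_div_pos.2 (by linarith)).trans hk
  have hkn : (k + 1 : ℝ) ≤ k * (θ * m) := by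
    rw [div_lt_iff₀ (by linarith)] at hk
    linarith
  let c : ℝ → ℝ := fun μ => K / k * ((μ / m) ^ (k + 1) + (k - (k + 1) / m * μ))
  have hBern : ∀ μ ∈ Set.Icc (0 : ℝ) 1, (k + 1) / m * μ ≤ (μ / m) ^ (k + 1) + k := fun μ hμ => by
    have := one_add_mul_le_pow (a := μ / m - 1)
      (by linarith [div_nonneg hμ.1 hm0.le]) (k + 1)
    rw [add_sub_cancel] at this
    push_cast at this
    have h : (k + 1) / m * μ = (k + 1) * (μ / m) := by ring
    linarith
  refine ⟨m, ⟨hm0, hm2⟩, c, ⟨by fun_prop, ?_, by fun_prop⟩, ?_, ?_, ?_, fun μ hμ => ⟨?_, ?_⟩⟩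
  · refine ⟨convex_Icc 0 1, fun x hx y hy hxy a b ha hb hab => ?_⟩
    have hk2 : 2 ≤ k + 1 := by
      have : 0 < k := by exact_mod_cast hk0
      omega
    have h := (strictConvexOn_pow hk2).2 (x := x / m) (div_nonneg hx.1 hm0.le)
      (y := y / m) (div_nonneg hy.1 hm0.le) (fun h => hxy (by field_simp at h; exact h)) ha hb hab
    simp only [smul_eq_mul, c] at h ⊢
    have hKk : 0 < K / k := by positivity
    have h' := mul_lt_mul_of_pos_left h hKk
    have e : (a * x + b * y) / m = a * (x / m) + b * (y / m) := by ring
    rw [e]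
    have hb' : b = 1 - a := by linarith
    subst hb'
    linarith
  · simp only [c, div_self hm0.ne', one_pow]
    field_simp
    ring
  · have h := (((((hasDerivAt_id m).div_const m).pow (k + 1)).add
      (((hasDerivAt_id m).const_mul ((k + 1) / m)).const_sub (k : ℝ))).const_mul (K / k))
    refine h.congr_deriv ?_
    simp only [id, div_self hm0.ne', one_pow]
    push_cast
    ring
  · simp [c]
    field_simp
  · have := hBern μ hμ
    exact mul_nonneg (by positivity) (by linarith)
  · have h1 : 0 ≤ (μ / m) ^ (k + 1) := pow_nonneg (div_nonneg hμ.1 hm0.le) _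
    have h2 : (k + 1) / m * μ ≤ k * θ * μ := by
      refine mul_le_mul_of_nonneg_right ?_ hμ.1
      rw [div_le_iff₀ hm0]
      linarith
    have h3 : K * (1 - θ * μ) = K / k * (k - k * θ * μ) := by field_simp
    rw [h3]
    exact mul_le_mul_of_nonneg_left (by linarith) (by positivity)

theorem not_selectedMore_of_lt_of_le {a0 a1 b0 b1 h0 h1 : ℝ} (hab0 : b0 < a0) (h0b : h0 < b0)
    (h1b : b1 ≤ h1) : ¬ SelectedMore a0 a1 b0 b1 h0 h1 := by
  set r := b0 - h0 with hr
  set M := r + (h1 - b1) with hM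
  have hr0 : 0 < r := by linarith
  have hM0 : 0 < M := by linarith
  have hW : 0 < a0 - b0 := by linarith
  -- a small prior `m`, with curvature of order `m⁻²`
  obtain ⟨m, hm0, hm⟩ : ∃ m, 0 < m ∧ m < min (min 1 (r / (2 * M))) ((a0 - b0) * r / M ^ 2) :=
    exists_between (by positivity)
  obtain ⟨hmm, hm3⟩ := lt_min_iff.1 hm
  obtain ⟨hm1, hm2⟩ := lt_min_iff.1 hmm
  rw [lt_div_iff₀ (by positivity)] at hm2 hm3
  set K := (a0 - b0) / (2 * m ^ 2) with hKdef
  have hK : 0 < K := by positivity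
  have hKm : K * m ^ 2 = (a0 - b0) / 2 := by rw [hKdef]; field_simp
  refine not_selectedMore_of_kernel (upsKernel_sq hK m) ⟨hm0, hm1⟩ (u := id) strictMono_id
    (concaveOn_id convex_univ) continuous_id (by simp) (hasDerivAt_sq K m)
    (fun μ _ => by positivity) (fun μ _ => ?_) (x := 0) (by simp) ?_
  · have hKr : M ^ 2 < 2 * K * r := by
      have : M ^ 2 * m ^ 2 < 2 * K * r * m ^ 2 := by
        have e : 2 * K * r * m ^ 2 = (a0 - b0) * r := by
          calc 2 * K * r * m ^ 2 = 2 * r * (K * m ^ 2) := by ring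
            _ = _ := by rw [hKm]; ring
        rw [e]
        nlinarith [mul_pos hm0 (sq_pos_of_pos hM0)]
      exact lt_of_mul_lt_mul_right this (by positivity)
    have key : 0 < K * (μ - m) ^ 2 - M * (μ - m) + r / 2 := by
      have : 0 < 4 * K * (K * (μ - m) ^ 2 - M * (μ - m) + r / 2) := by
        nlinarith [sq_nonneg (2 * K * (μ - m) - M)]
      exact pos_of_mul_pos_right this (by positivity)
    simp only [expUtil, id]
    have e : (1 - μ) * h0 + μ * h1 = (1 - μ) * b0 + μ * b1 - r + M * μ := by rw [hM, hr]; ring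
    rw [e]
    linarith
  · simp only [expUtil, id]
    linarith

theorem not_selectedMore_of_lt_of_lt {a0 a1 b0 b1 h0 h1 : ℝ} (hab0 : b0 < a0) (h0a : h0 < a0)
    (h1b : h1 < b1) : ¬ SelectedMore a0 a1 b0 b1 h0 h1 := by
  obtain ⟨G, hG, hGa⟩ := exists_between (max_lt (sub_pos.2 hab0) (sub_lt_sub_right h0a b0))
  obtain ⟨hG0, hGh⟩ := max_lt_iff.1 hG
  set w := h0 - b0 with hw
  have hθ : 0 < (b1 - h1) / (2 * (|w| + 1)) := div_pos (by linarith) (by positivity)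
  obtain ⟨m, hm, c, hc, hcm, hdc, hcz, hcb⟩ :=
    exists_kernel_nearly_affine (θ := 1 + (b1 - h1) / (2 * (|w| + 1))) (by linarith) hG0
  set θ := 1 + (b1 - h1) / (2 * (|w| + 1)) with hθdef
  refine not_selectedMore_of_kernel hc hm (u := id) strictMono_id
    (concaveOn_id convex_univ) continuous_id hcm hdc
    (fun μ hμ => (hcb μ hμ).1) (fun μ hμ => ?_) (x := 0) (by simp) ?_
  · have hwθ : w * (θ - 1) < b1 - h1 := by
      have : (θ - 1) * (2 * (|w| + 1)) = b1 - h1 := by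
        rw [hθdef, add_sub_cancel_left, div_mul_cancel₀ _ (by positivity)]
      have h1 : w * (θ - 1) ≤ |w| * (θ - 1) :=
        mul_le_mul_of_nonneg_right (le_abs_self w) (by linarith)
      have h2 : 0 ≤ |w| * (θ - 1) := mul_nonneg (abs_nonneg w) (by linarith)
      linarith
    obtain ⟨hc1, hc2⟩ := hcb μ hμ
    have e : expUtil id h0 h1 μ = expUtil id b0 b1 μ + ((1 - μ) * w - μ * (b1 - h1)) := by
      simp only [expUtil, id, hw]; ring
    rw [e]
    refine (add_lt_add_iff_left _).2 ?_
    obtain ⟨hμ0, hμ1⟩ := hμ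
    by_contra! hle
    have hv : 0 < b1 - h1 := by linarith
    rcases le_or_gt w 0 with hw0 | hw0
    · rcases hμ0.lt_or_eq with hμ0 | rfl
      · nlinarith [mul_pos hμ0 hv]
      · linarith
    · rcases le_or_gt (θ * μ) 1 with h | h
      · have : w * (1 - θ * μ) ≤ G * (1 - θ * μ) :=
          mul_le_mul_of_nonneg_right hGh.le (by linarith)
        rcases hμ0.lt_or_eq with hμ0 | rfl
        · nlinarith [mul_lt_mul_of_pos_right hwθ hμ0]
        · linarith
      · have hμ0 : 0 < μ := hμ0.lt_of_ne (by rintro rfl; linarith)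
        nlinarith [mul_lt_mul_of_pos_right hwθ hμ0, mul_lt_mul_of_pos_left h hw0]
  · simp only [expUtil, id, hcz]
    linarith

theorem strictMono_kink {ε : ℝ} (hε : 0 < ε) (k : ℝ) :
    StrictMono fun z : ℝ => min z (k + ε * (z - k)) :=
  fun x y h => by
    have := mul_lt_mul_of_pos_left h hε
    exact min_lt_min h (by linarith)

theorem concaveOn_kink (ε k : ℝ) :
    ConcaveOn ℝ Set.univ fun z : ℝ => min z (k + ε * (z - k)) := by
  refine (concaveOn_id convex_univ).inf ⟨convex_univ, fun x _ y _ a b _ _ hab => ?_⟩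
  obtain rfl : b = 1 - a := by linarith
  simp only [smul_eq_mul]
  linarith

theorem not_selectedMore_of_le_of_lt {a0 a1 b0 b1 h0 h1 : ℝ} (hab0 : b0 < a0) (hab1 : a1 < b1)
    (h0a : a0 ≤ h0) (h1a : h1 < a1) : ¬ SelectedMore a0 a1 b0 b1 h0 h1 := by
  set X := (h0 - a0) * (b1 - a1) with hX
  set Y := (a0 - b0) * (a1 - h1) with hY
  have hX0 : 0 ≤ X := mul_nonneg (by linarith) (by linarith)
  have hY0 : 0 < Y := mul_pos (by linarith) (by linarith)
  set ε := Y / (X + Y) with hε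
  have hε0 : 0 < ε := by positivity
  have hε1 : ε ≤ 1 := by rw [hε, div_le_one (by positivity)]; linarith
  have hεX : ε * X < Y := by
    rw [hε, div_mul_eq_mul_div, div_lt_iff₀ (by positivity)]
    nlinarith
  let u : ℝ → ℝ := fun z => min z (a0 + ε * (z - a0))
  have hu : StrictMono u := strictMono_kink hε0 a0
  have huc : ConcaveOn ℝ Set.univ u := concaveOn_kink ε a0
  have hua0 : u a0 = a0 := by simp [u]
  have hub0 : u b0 = b0 := min_eq_left (by nlinarith)
  have huh0 : u h0 = a0 + ε * (h0 - a0) := min_eq_right (by nlinarith)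
  set V := u b1 - u a1 with hV
  have hV0 : 0 < V := sub_pos.2 (hu hab1)
  have hslope : V * (a1 - h1) ≤ (u a1 - u h1) * (b1 - a1) := by
    have := huc.slope_anti_adjacent (Set.mem_univ h1) (Set.mem_univ b1) h1a hab1
    rwa [div_le_div_iff₀ (by linarith) (by linarith)] at this
  have hW : 0 < a0 - b0 := by linarith
  have hS : 0 < a0 - b0 + V := by linarith
  -- `m` is the belief at which `a` and `b` are indifferent
  set m := (a0 - b0) / (a0 - b0 + V) with hm
  have hmS : m * (a0 - b0 + V) = a0 - b0 := div_mul_cancel₀ _ hS.ne'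
  have hm0 : 0 < m := by positivity
  have hm1 : m < 1 := by rw [hm, div_lt_one hS]; linarith
  have ea : ∀ μ, expUtil u a0 a1 μ - expUtil u b0 b1 μ = -(a0 - b0 + V) * (μ - m) := fun μ => by
    simp only [expUtil, hua0, hub0]
    linarith
  have hloss : V * (ε * (h0 - a0)) < (a0 - b0) * (u a1 - u h1) := by
    have h1 : V * (ε * (h0 - a0)) * (b1 - a1) < (a0 - b0) * (u a1 - u h1) * (b1 - a1) := by
      calc V * (ε * (h0 - a0)) * (b1 - a1) = V * (ε * X) := by rw [hX]; ring
        _ < V * Y := mul_lt_mul_of_pos_left hεX hV0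
        _ = (a0 - b0) * (V * (a1 - h1)) := by rw [hY]; ring
        _ ≤ (a0 - b0) * ((u a1 - u h1) * (b1 - a1)) := mul_le_mul_of_nonneg_left hslope hW.le
        _ = _ := by ring
    exact lt_of_mul_lt_mul_right h1 (by linarith)
  obtain ⟨r, hr⟩ : ∃ r, r = expUtil u b0 b1 m - expUtil u h0 h1 m := ⟨_, rfl⟩
  have hr0 : 0 < r := by
    have h1 : r * (a0 - b0 + V) = (a0 - b0) * (u a1 - u h1) - V * (ε * (h0 - a0)) := by
      have := ea m
      have e : r = m * (u a1 - u h1) - (1 - m) * (ε * (h0 - a0)) := by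
        rw [sub_self, mul_zero] at this
        rw [hr, ← sub_eq_zero.1 this]
        simp only [expUtil, hua0, huh0]
        ring
      rw [e]
      linear_combination (u a1 - u h1 + ε * (h0 - a0)) * hmS
    exact pos_of_mul_pos_left (h1 ▸ sub_pos.2 hloss) hS.le
  obtain ⟨M, hM⟩ : ∃ M, M = (u h1 - u h0) - (u b1 - u b0) := ⟨_, rfl⟩
  have eh : ∀ μ, expUtil u h0 h1 μ = expUtil u b0 b1 μ - r + M * (μ - m) := fun μ => by
    simp only [hr, hM, expUtil]
    ring
  set K := (M ^ 2 + 1) / r with hK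
  have hK0 : 0 < K := by positivity
  have hKr : K * r = M ^ 2 + 1 := div_mul_cancel₀ _ hr0.ne'
  obtain ⟨d, hd0, hd⟩ : ∃ d, 0 < d ∧ d < min m ((a0 - b0 + V) / K) :=
    exists_between (by positivity)
  obtain ⟨hd1, hd2⟩ := lt_min_iff.1 hd
  rw [lt_div_iff₀ hK0] at hd2
  refine not_selectedMore_of_kernel (upsKernel_sq hK0 m) ⟨hm0, hm1⟩ hu huc (by fun_prop)
    (by simp) (hasDerivAt_sq K m) (fun μ _ => by positivity) (fun μ _ => ?_)
    (x := m - d) ⟨by linarith, by linarith⟩ ?_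
  · have key : 0 < K * (μ - m) ^ 2 - M * (μ - m) + r := by
      have : 0 < 4 * K * (K * (μ - m) ^ 2 - M * (μ - m) + r) := by
        nlinarith [sq_nonneg (2 * K * (μ - m) - M)]
      exact pos_of_mul_pos_right this (by positivity)
    rw [eh]
    linarith
  · have h := ea (m - d)
    have hlt := mul_lt_mul_of_pos_right hd2 hd0
    simp only [sub_sub_cancel_left] at h ⊢
    linarith

theorem selectedMore_of_dominates {a0 a1 b0 b1 h0 h1 : ℝ} (hab0 : b0 < a0) (hab1 : a1 < b1)
    (h0a : a0 ≤ h0) (h1a : a1 ≤ h1) : SelectedMore a0 a1 b0 b1 h0 h1 := by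
  intro c hc m hm u hu _ _ p hp
  rcases le_or_gt b1 h1 with hb1 | hb1
  · exact ⟨1, optChoiceProb_one_of_dominates hc hm hu.monotone (hab0.le.trans h0a) hb1, hp.le_one⟩
  by_cases hne : a0 < h0 ∨ a1 < h1
  · obtain ⟨ph, hph⟩ := exists_optChoiceProb hc.1 hm u h0 h1 b0 b1
    obtain ⟨_, _, _, _, hsol⟩ := hp.exists_isBinarySolution hc.1 hc.2.1 hm
    obtain ⟨_, _, _, _, hsol'⟩ := hph.exists_isBinarySolution hc.1 hc.2.1 hm
    exact ⟨ph, hph, hsol.prob_mono hc.2.1 hm hsol' (hu hab0) (hu hab1) (hu.monotone h0a)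
      (hu.monotone h1a) (hu hb1) (hne.imp (@hu _ _) (@hu _ _))⟩
  · push Not at hne
    obtain rfl := le_antisymm h0a hne.1
    obtain rfl := le_antisymm h1a hne.2
    exact ⟨p, hp, le_rfl⟩

/-- Proposition (two states): `ahat` is selected more than `a` iff `ahat`
state-wise dominates `a` or `b`. -/
theorem selectedMore_iff (a0 a1 b0 b1 h0 h1 : ℝ)
    (hab0 : a0 > b0) (hab1 : b1 > a1) :
    SelectedMore a0 a1 b0 b1 h0 h1 ↔
      ((h0 ≥ a0 ∧ h1 ≥ a1) ∨ (h0 ≥ b0 ∧ h1 ≥ b1)) := by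
  constructor
  · contrapose!
    rintro ⟨hA, hB⟩
    rcases lt_or_ge h1 b1 with hb1 | hb1
    · rcases lt_or_ge h0 a0 with ha0 | ha0
      · exact not_selectedMore_of_lt_of_lt hab0 ha0 hb1
      · exact not_selectedMore_of_le_of_lt hab0 hab1 ha0 (hA ha0)
    · exact not_selectedMore_of_lt_of_le hab0 (not_le.1 fun h => (hB h).not_ge hb1) hb1
  · rintro (⟨ha0, ha1⟩ | ⟨hb0, hb1⟩)
    · exact selectedMore_of_dominates hab0 hab1 ha0 ha1
    · intro c hc m hm u hu _ _ p hp
      exact ⟨1, optChoiceProb_one_of_dominates hc hm hu.monotone hb0 hb1, hp.le_one⟩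
end

section
/- With three states, state-wise dominance is not sufficient for being selected more under flexible information acquisition: there exist payoff vectors a, â, b ∈ ℝ³ with â ≥ a componentwise and â ≠ a, a strictly increasing, concave, continuous utility u, a UPS cost c on the 2-simplex, and an interior prior μ₀, such that some optimal choice probability p of a strictly exceeds every optimal choice probability p̂ of â; in particular, â is not selected more than a. -/
open MeasureTheory

/-- Beliefs over three states. -/
abbrev Belief3 := Fin 3 → ℝ

/-- The 2-dimensional probability simplex. -/
def simplex3 : Set Belief3 := stdSimplex ℝ (Fin 3)

/-- The (relative) interior of the simplex: strictly positive beliefs. -/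
def interiorSimplex3 : Set Belief3 := {μ | (∀ θ, 0 < μ θ) ∧ ∑ θ, μ θ = 1}

/-- Expected utility of action `x` at belief `μ`. -/
def expUtil3 (u : ℝ → ℝ) (x : Fin 3 → ℝ) (μ : Belief3) : ℝ :=
  ∑ θ, μ θ * u (x θ)

/-- A UPS cost kernel on the 2-simplex: continuous and strictly convex on the
simplex, twice continuously differentiable on its (relative) interior. -/
def UPSKernel3 (c : Belief3 → ℝ) : Prop :=
  ContinuousOn c simplex3 ∧ StrictConvexOn ℝ simplex3 c ∧
    ContDiffOn ℝ 2 c interiorSimplex3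

/-- A Bayes-plausible distribution over posteriors with prior (barycenter) `μ₀`. -/
def Feasible3 (μ₀ : Belief3) (F : Measure Belief3) : Prop :=
  IsProbabilityMeasure F ∧ F simplex3ᶜ = 0 ∧ ∀ θ, (∫ μ, μ θ ∂F) = μ₀ θ

/-- `F` solves the flexible information acquisition problem with value
function `W`, prior `μ₀`, and UPS cost induced by `c`. -/
def Optimal3 (c : Belief3 → ℝ) (μ₀ : Belief3) (W : Belief3 → ℝ)
    (F : Measure Belief3) : Prop :=
  Feasible3 μ₀ F ∧ ∀ F' : Measure Belief3, Feasible3 μ₀ F' →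
    (∫ μ, W μ ∂F) - ((∫ μ, c μ ∂F) - c μ₀) ≥
      (∫ μ, W μ ∂F') - ((∫ μ, c μ ∂F') - c μ₀)

/-- `p` is an optimal choice probability of action `x` against action `bv`. -/
def OptChoiceProb3 (c : Belief3 → ℝ) (μ₀ : Belief3) (u : ℝ → ℝ)
    (x bv : Fin 3 → ℝ) (p : ℝ) : Prop :=
  ∃ F : Measure Belief3,
    Optimal3 c μ₀ (fun μ => max (expUtil3 u x μ) (expUtil3 u bv μ)) F ∧
    ∃ σ : Belief3 → Bool, Measurable σ ∧
      (∀ μ, σ μ = true → expUtil3 u x μ ≥ expUtil3 u bv μ) ∧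
      (∀ μ, σ μ = false → expUtil3 u bv μ ≥ expUtil3 u x μ) ∧
      p = (F {μ | σ μ = true}).toReal

/-- `ahat` is selected more than `a` (against `bv`). -/
def SelectedMore3 (a bv ahat : Fin 3 → ℝ) : Prop :=
  ∀ c : Belief3 → ℝ, UPSKernel3 c → ∀ μ₀ ∈ interiorSimplex3,
    ∀ u : ℝ → ℝ, StrictMono u → ConcaveOn ℝ Set.univ u → Continuous u →
      ∀ p : ℝ, OptChoiceProb3 c μ₀ u a bv p →
        ∃ ph : ℝ, OptChoiceProb3 c μ₀ u ahat bv ph ∧ ph ≥ p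

/-- The cost kernel `∑ θ, μ θ ^ 3`. -/
def cubicKernel (μ : Belief3) : ℝ := ∑ θ, μ θ ^ 3

/-- The tangent functional of `cubicKernel` at `w`. -/
def cubicTangent (w μ : Belief3) : ℝ := ∑ θ, (3 * w θ ^ 2 * μ θ - 2 * w θ ^ 3)

/-- The payoff vector whose expectation at a belief is the difference between the tangent
functionals of `cubicKernel` at `ν` and at `w`. -/
def tangentGap (ν w : Belief3) (θ : Fin 3) : ℝ :=
  3 * (ν θ ^ 2 - w θ ^ 2) - 2 * ∑ i, (ν i ^ 3 - w i ^ 3)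

/-- The distribution with mass `t` at `ν` and mass `1 - t` at `w`. -/
noncomputable def twoPoint (t : ℝ) (ν w : Belief3) : Measure Belief3 :=
  ENNReal.ofReal t • Measure.dirac ν + ENNReal.ofReal (1 - t) • Measure.dirac w

lemma measurableSet_simplex3 : MeasurableSet simplex3 :=
  (isCompact_stdSimplex ℝ (Fin 3)).isClosed.measurableSet

lemma continuous_cubicKernel : Continuous cubicKernel := by
  unfold cubicKernel; fun_prop

lemma continuous_cubicTangent (w : Belief3) : Continuous (cubicTangent w) := by
  unfold cubicTangent; fun_prop

lemma continuous_expUtil3 (u : ℝ → ℝ) (x : Fin 3 → ℝ) : Continuous (expUtil3 u x) := by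
  unfold expUtil3; fun_prop

lemma cubicTangent_self (w : Belief3) : cubicTangent w w = cubicKernel w := by
  simp only [cubicTangent, cubicKernel, Fin.sum_univ_three]; ring

lemma cubicTangent_lt {w μ : Belief3} (hw : ∀ θ, 0 ≤ w θ) (hμ : ∀ θ, 0 ≤ μ θ) (hne : μ ≠ w) :
    cubicTangent w μ < cubicKernel μ := by
  obtain ⟨i, hi⟩ := Function.ne_iff.mp hne
  have factor : ∀ θ, μ θ ^ 3 - (3 * w θ ^ 2 * μ θ - 2 * w θ ^ 3) =
      (μ θ - w θ) ^ 2 * (μ θ + 2 * w θ) := fun θ => by ring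
  refine Finset.sum_lt_sum (fun θ _ => ?_) ⟨i, Finset.mem_univ i, ?_⟩
  · rw [← sub_nonneg, factor]
    have := hw θ
    have := hμ θ
    positivity
  · rw [← sub_pos, factor]
    have hpos : 0 < μ i + 2 * w i := by
      rcases (hw i).lt_or_eq with h | h
      · linarith [hμ i]
      · rcases (hμ i).lt_or_eq with h' | h'
        · linarith
        · exact absurd (h'.symm.trans h) hi
    have := sq_pos_of_ne_zero (sub_ne_zero.mpr hi)
    positivity

lemma cubicTangent_le {w μ : Belief3} (hw : ∀ θ, 0 ≤ w θ) (hμ : ∀ θ, 0 ≤ μ θ) :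
    cubicTangent w μ ≤ cubicKernel μ := by
  by_cases h : μ = w
  · rw [h, cubicTangent_self]
  · exact (cubicTangent_lt hw hμ h).le

lemma cubicTangent_convexComb (z x y : Belief3) {a b : ℝ} (hab : a + b = 1) :
    cubicTangent z (a • x + b • y) = a * cubicTangent z x + b * cubicTangent z y := by
  obtain rfl : b = 1 - a := by linarith
  simp only [cubicTangent, Fin.sum_univ_three, Pi.add_apply, Pi.smul_apply, smul_eq_mul]
  ring

lemma upsKernel3_cubicKernel : UPSKernel3 cubicKernel := by
  refine ⟨continuous_cubicKernel.continuousOn,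
    ⟨convex_stdSimplex ℝ (Fin 3), fun x hx y hy hxy a b ha hb hab => ?_⟩, ?_⟩
  · have hz : ∀ θ, 0 ≤ (a • x + b • y) θ :=
      (convex_stdSimplex ℝ (Fin 3) hx hy ha.le hb.le hab).1
    have hzx : x ≠ a • x + b • y := by
      intro h
      apply hxy
      obtain rfl : a = 1 - b := by linarith
      funext θ
      have h1 : x θ = (1 - b) * x θ + b * y θ := congrFun h θ
      exact mul_left_cancel₀ hb.ne' (by linarith)
    have h1 := cubicTangent_lt hz hx.1 hzx
    have h2 := cubicTangent_le hz hy.1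
    rw [← cubicTangent_self, cubicTangent_convexComb _ _ _ hab, smul_eq_mul, smul_eq_mul]
    have := mul_lt_mul_of_pos_left h1 ha
    have := mul_le_mul_of_nonneg_left h2 hb.le
    linarith
  · unfold cubicKernel
    fun_prop

lemma expUtil3_tangentGap (ν w : Belief3) {μ : Belief3} (hμ : μ ∈ simplex3) :
    expUtil3 id (tangentGap ν w) μ = cubicTangent ν μ - cubicTangent w μ := by
  have hs := hμ.2
  simp only [Fin.sum_univ_three] at hs
  have h2 : μ 2 = 1 - μ 0 - μ 1 := by linarith
  simp only [expUtil3, tangentGap, cubicTangent, Fin.sum_univ_three, id, h2]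
  ring

lemma expUtil3_id_zero (μ : Belief3) : expUtil3 id 0 μ = 0 := by
  simp [expUtil3]

lemma Feasible3.ae_mem {μ₀ : Belief3} {F : Measure Belief3} (hF : Feasible3 μ₀ F) :
    ∀ᵐ μ ∂F, μ ∈ simplex3 := by
  simpa [ae_iff, Set.compl_def] using hF.2.1

lemma Feasible3.integrable {μ₀ : Belief3} {F : Measure Belief3} (hF : Feasible3 μ₀ F)
    {f : Belief3 → ℝ} (hf : Continuous f) : Integrable f F := by
  have := hF.1
  have h : IntegrableOn f simplex3 F :=
    hf.continuousOn.integrableOn_compact (isCompact_stdSimplex ℝ (Fin 3))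
  rwa [IntegrableOn, Measure.restrict_eq_self_of_ae_mem hF.ae_mem] at h

lemma Feasible3.integral_cubicTangent {μ₀ : Belief3} {F : Measure Belief3}
    (hF : Feasible3 μ₀ F) (w : Belief3) : ∫ μ, cubicTangent w μ ∂F = cubicTangent w μ₀ := by
  have := hF.1
  have hi : ∀ θ, Integrable (fun μ : Belief3 => 3 * w θ ^ 2 * μ θ) F :=
    fun θ => hF.integrable (by fun_prop)
  unfold cubicTangent
  rw [integral_finsetSum _ fun θ _ => by exact (hi θ).sub (integrable_const _)]
  refine Finset.sum_congr rfl fun θ _ => ?_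
  rw [integral_sub (hi θ) (integrable_const _), integral_const_mul, hF.2.2 θ]
  simp

lemma integral_twoPoint {t : ℝ} (h0 : 0 ≤ t) (h1 : t ≤ 1) (ν w : Belief3) (f : Belief3 → ℝ) :
    ∫ μ, f μ ∂(twoPoint t ν w) = t * f ν + (1 - t) * f w := by
  have hd : ∀ x : Belief3, Integrable f (Measure.dirac x) := fun x =>
    integrable_dirac (by simp)
  rw [twoPoint, integral_add_measure ((hd ν).smul_measure (by simp))
    ((hd w).smul_measure (by simp)), integral_smul_measure, integral_smul_measure,
    integral_dirac, integral_dirac, ENNReal.toReal_ofReal h0,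
    ENNReal.toReal_ofReal (sub_nonneg.mpr h1), smul_eq_mul, smul_eq_mul]

lemma feasible3_twoPoint {t : ℝ} (h0 : 0 ≤ t) (h1 : t ≤ 1) {ν w : Belief3}
    (hν : ν ∈ simplex3) (hw : w ∈ simplex3) :
    Feasible3 (t • ν + (1 - t) • w) (twoPoint t ν w) := by
  refine ⟨⟨?_⟩, ?_, fun θ => ?_⟩
  · simp [twoPoint, ← ENNReal.ofReal_add h0 (sub_nonneg.mpr h1)]
  · simp [twoPoint, Measure.dirac_apply' _ measurableSet_simplex3.compl, hν, hw]
  · rw [integral_twoPoint h0 h1]; simp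

section TangentGap

variable {ν w μ₀ : Belief3} {F : Measure Belief3}

local notation "W" => fun μ => max (expUtil3 id (tangentGap ν w) μ) (expUtil3 id 0 μ)

lemma netValue_le (hν : ν ∈ simplex3) (hw : w ∈ simplex3) {μ : Belief3} (hμ : μ ∈ simplex3) :
    max (expUtil3 id (tangentGap ν w) μ) (expUtil3 id 0 μ) ≤
      cubicKernel μ - cubicTangent w μ := by
  rw [expUtil3_tangentGap ν w hμ, expUtil3_id_zero]
  refine max_le ?_ ?_
  · linarith [cubicTangent_le hν.1 hμ.1]
  · linarith [cubicTangent_le hw.1 hμ.1]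

lemma eq_or_eq_of_netValue_eq (hν : ν ∈ simplex3) (hw : w ∈ simplex3) {μ : Belief3}
    (hμ : μ ∈ simplex3)
    (h : max (expUtil3 id (tangentGap ν w) μ) (expUtil3 id 0 μ) =
      cubicKernel μ - cubicTangent w μ) : μ = ν ∨ μ = w := by
  by_contra! hne
  refine h.not_lt ?_
  rw [expUtil3_tangentGap ν w hμ, expUtil3_id_zero]
  refine max_lt ?_ ?_
  · linarith [cubicTangent_lt hν.1 hμ.1 hne.1]
  · linarith [cubicTangent_lt hw.1 hμ.1 hne.2]

lemma expUtil3_tangentGap_pos (hν : ν ∈ simplex3) (hw : w ∈ simplex3) (hne : ν ≠ w) :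
    0 < expUtil3 id (tangentGap ν w) ν := by
  rw [expUtil3_tangentGap ν w hν, cubicTangent_self]
  linarith [cubicTangent_lt hw.1 hν.1 hne]

lemma expUtil3_tangentGap_neg (hν : ν ∈ simplex3) (hw : w ∈ simplex3) (hne : ν ≠ w) :
    expUtil3 id (tangentGap ν w) w < 0 := by
  rw [expUtil3_tangentGap ν w hw, cubicTangent_self]
  linarith [cubicTangent_lt hν.1 hw.1 hne.symm]

lemma Feasible3.integrable_value (hF : Feasible3 μ₀ F) : Integrable W F :=
  hF.integrable ((continuous_expUtil3 _ _).max (continuous_expUtil3 _ _))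

lemma Feasible3.integrable_bound (hF : Feasible3 μ₀ F) :
    Integrable (fun μ => cubicKernel μ - cubicTangent w μ) F :=
  hF.integrable (continuous_cubicKernel.sub (continuous_cubicTangent w))

lemma Feasible3.integral_bound (hF : Feasible3 μ₀ F) :
    ∫ μ, (cubicKernel μ - cubicTangent w μ) ∂F =
      ∫ μ, cubicKernel μ ∂F - cubicTangent w μ₀ := by
  rw [integral_sub (hF.integrable continuous_cubicKernel)
    (hF.integrable (continuous_cubicTangent w)), hF.integral_cubicTangent]

lemma Feasible3.integral_value_le (hν : ν ∈ simplex3) (hw : w ∈ simplex3)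
    (hF : Feasible3 μ₀ F) :
    ∫ μ, W μ ∂F ≤ ∫ μ, cubicKernel μ ∂F - cubicTangent w μ₀ := by
  rw [← hF.integral_bound]
  exact integral_mono_ae hF.integrable_value hF.integrable_bound
    (hF.ae_mem.mono fun μ hμ => netValue_le hν hw hμ)

lemma integral_value_twoPoint (hν : ν ∈ simplex3) (hw : w ∈ simplex3) (hne : ν ≠ w)
    {t : ℝ} (h0 : 0 ≤ t) (h1 : t ≤ 1) :
    ∫ μ, W μ ∂(twoPoint t ν w) =
      ∫ μ, cubicKernel μ ∂(twoPoint t ν w) - cubicTangent w (t • ν + (1 - t) • w) := by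
  rw [integral_twoPoint h0 h1, integral_twoPoint h0 h1, cubicTangent_convexComb _ _ _ (by ring)]
  simp only [expUtil3_id_zero]
  rw [max_eq_left (expUtil3_tangentGap_pos hν hw hne).le,
    max_eq_right (expUtil3_tangentGap_neg hν hw hne).le, expUtil3_tangentGap ν w hν,
    cubicTangent_self, cubicTangent_self]
  ring

lemma optimal3_twoPoint (hν : ν ∈ simplex3) (hw : w ∈ simplex3) (hne : ν ≠ w)
    {t : ℝ} (h0 : 0 ≤ t) (h1 : t ≤ 1) :
    Optimal3 cubicKernel (t • ν + (1 - t) • w) W (twoPoint t ν w) := by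
  refine ⟨feasible3_twoPoint h0 h1 hν hw, fun F' hF' => ?_⟩
  have h := hF'.integral_value_le hν hw
  have h' := integral_value_twoPoint hν hw hne h0 h1
  linarith

lemma optChoiceProb3_tangentGap (hν : ν ∈ simplex3) (hw : w ∈ simplex3) (hne : ν ≠ w)
    {t : ℝ} (h0 : 0 ≤ t) (h1 : t ≤ 1) :
    OptChoiceProb3 cubicKernel (t • ν + (1 - t) • w) id (tangentGap ν w) 0 t := by
  classical
  have hmeas : MeasurableSet {μ | 0 ≤ expUtil3 id (tangentGap ν w) μ} :=
    (isClosed_le continuous_const (continuous_expUtil3 _ _)).measurableSet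
  refine ⟨twoPoint t ν w, optimal3_twoPoint hν hw hne h0 h1,
    fun μ => decide (0 ≤ expUtil3 id (tangentGap ν w) μ), ?_, fun μ h => ?_, fun μ h => ?_, ?_⟩
  · exact measurable_to_bool (by simpa [Set.preimage] using hmeas)
  · simpa [expUtil3_id_zero] using h
  · rw [expUtil3_id_zero]
    exact (not_le.mp (of_decide_eq_false h)).le
  · simp only [decide_eq_true_eq]
    simp [twoPoint, Measure.dirac_apply' _ hmeas, Set.indicator,
      (expUtil3_tangentGap_pos hν hw hne).le, (expUtil3_tangentGap_neg hν hw hne).not_ge, h0]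

lemma Optimal3.ae_eq_or_eq (hν : ν ∈ simplex3) (hw : w ∈ simplex3) (hne : ν ≠ w)
    {t : ℝ} (h0 : 0 ≤ t) (h1 : t ≤ 1)
    (hF : Optimal3 cubicKernel (t • ν + (1 - t) • w) W F) : ∀ᵐ μ ∂F, μ = ν ∨ μ = w := by
  have hle := hF.2 _ (feasible3_twoPoint h0 h1 hν hw)
  have h' := integral_value_twoPoint hν hw hne h0 h1
  have heq : ∫ μ, W μ ∂F = ∫ μ, (cubicKernel μ - cubicTangent w μ) ∂F := by
    have := hF.1.integral_value_le hν hw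
    rw [hF.1.integral_bound]
    linarith
  have hae := (integral_eq_iff_of_ae_le hF.1.integrable_value hF.1.integrable_bound
    (hF.1.ae_mem.mono fun μ hμ => netValue_le hν hw hμ)).mp heq
  filter_upwards [hae, hF.1.ae_mem] with μ h hμ
  exact eq_or_eq_of_netValue_eq hν hw hμ h

lemma OptChoiceProb3.eq_of_tangentGap (hν : ν ∈ simplex3) (hw : w ∈ simplex3) (hne : ν ≠ w)
    {t p : ℝ} (h0 : 0 ≤ t) (h1 : t ≤ 1)
    (h : OptChoiceProb3 cubicKernel (t • ν + (1 - t) • w) id (tangentGap ν w) 0 p) :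
    p = t := by
  obtain ⟨F, hF, σ, hσ, htrue, hfalse, rfl⟩ := h
  have := hF.1.1
  obtain ⟨i, hi⟩ := Function.ne_iff.mp hne
  have hσν : σ ν = true := by
    by_contra hc
    have := hfalse ν (by simpa using hc)
    rw [expUtil3_id_zero] at this
    exact absurd (expUtil3_tangentGap_pos hν hw hne) this.not_gt
  have hσw : σ w = false := by
    by_contra hc
    have := htrue w (by simpa using hc)
    rw [expUtil3_id_zero] at this
    exact absurd (expUtil3_tangentGap_neg hν hw hne) this.not_gt
  have hS : MeasurableSet {μ | σ μ = true} := hσ (measurableSet_singleton true)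
  have hae : (fun μ : Belief3 => μ i) =ᵐ[F]
      fun μ => w i + {μ | σ μ = true}.indicator (fun _ => ν i - w i) μ := by
    filter_upwards [hF.ae_eq_or_eq hν hw hne h0 h1] with μ hμ
    rcases hμ with rfl | rfl
    · simp [hσν]
    · simp [hσw]
  have hint := hF.1.2.2 i
  rw [integral_congr_ae hae, integral_add (integrable_const _)
    ((integrable_const _).indicator hS), integral_indicator_const _ hS] at hint
  simp only [integral_const, probReal_univ, Pi.add_apply, Pi.smul_apply, smul_eq_mul] at hint
  exact mul_right_cancel₀ (sub_ne_zero.mpr hi) (by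
    change F.real _ * _ = _
    linarith)

end TangentGap

/-- With three states, state-wise dominance is not sufficient for being
selected more: there are `a`, `ahat ≥ a` (with `ahat ≠ a`), `b`, a utility, a
UPS cost, and an interior prior such that some optimal choice probability of
`a` strictly exceeds every optimal choice probability of `ahat`; in
particular, `ahat` is not selected more than `a`. -/
theorem dominance_insufficient_three_states :
    ∃ (a ahat bv : Fin 3 → ℝ) (u : ℝ → ℝ) (c : Belief3 → ℝ)
      (μ₀ : Belief3) (p : ℝ),
      (∀ θ, ahat θ ≥ a θ) ∧ ahat ≠ a ∧
      StrictMono u ∧ ConcaveOn ℝ Set.univ u ∧ Continuous u ∧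
      UPSKernel3 c ∧ μ₀ ∈ interiorSimplex3 ∧
      OptChoiceProb3 c μ₀ u a bv p ∧
      (∀ ph : ℝ, OptChoiceProb3 c μ₀ u ahat bv ph → p > ph) ∧
      ¬ SelectedMore3 a bv ahat := by
  have mem : ∀ x y z : ℝ, 0 ≤ x → 0 ≤ y → 0 ≤ z → x + y + z = 1 → ![x, y, z] ∈ simplex3 := by
    intro x y z hx hy hz h
    refine ⟨fun θ => ?_, by simpa [Fin.sum_univ_three] using h⟩
    fin_cases θ <;> assumption
  have hν := mem 0 (1 / 16) (15 / 16) (by norm_num) (by norm_num) (by norm_num) (by norm_num)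
  have hw := mem (5 / 16) (11 / 16) 0 (by norm_num) (by norm_num) (by norm_num) (by norm_num)
  have hν' := mem (1 / 8) 0 (7 / 8) (by norm_num) (by norm_num) (by norm_num) (by norm_num)
  have hw' := mem (1 / 8) (3 / 4) (1 / 8) (by norm_num) (by norm_num) (by norm_num) (by norm_num)
  set ν : Belief3 := ![0, 1 / 16, 15 / 16] with ν_def
  set w : Belief3 := ![5 / 16, 11 / 16, 0] with w_def
  set ν' : Belief3 := ![1 / 8, 0, 7 / 8] with ν'_def
  set w' : Belief3 := ![1 / 8, 3 / 4, 1 / 8] with w'_def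
  have hne : ν ≠ w := fun h => by simpa [ν_def, w_def] using congrFun h 2
  have hne' : ν' ≠ w' := fun h => by
    have := congrFun h 1
    norm_num [ν'_def, w'_def] at this
  have prior : (7 / 12 : ℝ) • ν' + (1 - 7 / 12 : ℝ) • w' =
      (3 / 5 : ℝ) • ν + (1 - 3 / 5 : ℝ) • w := by
    funext θ
    fin_cases θ <;> simp [ν_def, w_def, ν'_def, w'_def] <;> norm_num
  have hopt := optChoiceProb3_tangentGap hν hw hne (t := 3 / 5) (by norm_num) (by norm_num)
  have huniq : ∀ ph, OptChoiceProb3 cubicKernel ((3 / 5 : ℝ) • ν + (1 - 3 / 5 : ℝ) • w) id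
      (tangentGap ν' w') 0 ph → (3 / 5 : ℝ) > ph := by
    intro ph h
    rw [← prior] at h
    rw [h.eq_of_tangentGap hν' hw' hne' (by norm_num) (by norm_num)]
    norm_num
  have hprior : (3 / 5 : ℝ) • ν + (1 - 3 / 5 : ℝ) • w ∈ interiorSimplex3 := by
    refine ⟨fun θ => ?_, ?_⟩
    · fin_cases θ <;> simp [ν_def, w_def] <;> norm_num
    · simp [ν_def, w_def, Fin.sum_univ_three]; norm_num
  refine ⟨tangentGap ν w, tangentGap ν' w', 0, id, cubicKernel, _, 3 / 5, fun θ => ?_,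
    fun h => ?_, strictMono_id, concaveOn_id convex_univ, continuous_id, upsKernel3_cubicKernel,
    hprior, hopt, huniq, fun hsel => ?_⟩
  · fin_cases θ <;>
      simp [tangentGap, ν_def, w_def, ν'_def, w'_def, Fin.sum_univ_three] <;> norm_num
  · have := congrFun h 0
    simp [tangentGap, ν_def, w_def, ν'_def, w'_def, Fin.sum_univ_three] at this
    norm_num at this
  · obtain ⟨ph, hph, hge⟩ := hsel cubicKernel upsKernel3_cubicKernel _ hprior id strictMono_id
      (concaveOn_id convex_univ) continuous_id _ hopt
    exact absurd (huniq ph hph) hge.not_gt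
end

section
/- In the bilateral trade setting, a new continuous trade agreement γ̂ : Θ → ℝ must be acceptable if and only if there exists λ ∈ (0,1] such that γ̂(θ) = λ·γ(θ) + (1−λ)·v(θ) for every θ ∈ Θ. -/
open MeasureTheory

/-- The new trade agreement `γhat` must be acceptable: for every strictly
increasing, concave, continuous utility and every Borel probability measure
(belief), whenever the buyer (resp. seller) weakly/strictly prefers the status
quo agreement `γ` to her outside option, she also weakly/strictly prefers
`γhat` to her outside option. -/
def MustBeAcceptable {Θ : Type*} [TopologicalSpace Θ] [MeasurableSpace Θ]
    (v γ γhat : C(Θ, ℝ)) : Prop :=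
  ∀ u : ℝ → ℝ, StrictMono u → ConcaveOn ℝ Set.univ u → Continuous u →
    ∀ μ : Measure Θ, IsProbabilityMeasure μ →
      (((∫ θ, u (v θ - γ θ) ∂μ) ≥ u 0 → (∫ θ, u (v θ - γhat θ) ∂μ) ≥ u 0) ∧
        ((∫ θ, u (v θ - γ θ) ∂μ) > u 0 → (∫ θ, u (v θ - γhat θ) ∂μ) > u 0)) ∧
      (((∫ θ, u (γ θ) ∂μ) ≥ (∫ θ, u (v θ) ∂μ) →
          (∫ θ, u (γhat θ) ∂μ) ≥ (∫ θ, u (v θ) ∂μ)) ∧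
        ((∫ θ, u (γ θ) ∂μ) > (∫ θ, u (v θ) ∂μ) →
          (∫ θ, u (γhat θ) ∂μ) > (∫ θ, u (v θ) ∂μ)))

theorem le_integral_comp_convexCombination {Θ : Type*} [TopologicalSpace Θ] [CompactSpace Θ]
    [MeasurableSpace Θ] [OpensMeasurableSpace Θ] {μ : Measure Θ} [IsFiniteMeasure μ]
    {u : ℝ → ℝ} (hu : ConcaveOn ℝ Set.univ u) (huc : Continuous u) {f g : Θ → ℝ}
    (hf : Continuous f) (hg : Continuous g) {l : ℝ} (hl0 : 0 ≤ l) (hl1 : l ≤ 1) :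
    l * (∫ θ, u (f θ) ∂μ) + (1 - l) * (∫ θ, u (g θ) ∂μ) ≤
      ∫ θ, u (l * f θ + (1 - l) * g θ) ∂μ := by
  have hint : ∀ h : Θ → ℝ, Continuous h → Integrable h μ := fun h hh =>
    hh.integrable_of_hasCompactSupport (HasCompactSupport.of_compactSpace h)
  rw [← integral_const_mul, ← integral_const_mul,
    ← integral_add (hint _ (by fun_prop)) (hint _ (by fun_prop))]
  refine integral_mono (hint _ (by fun_prop)) (hint _ (by fun_prop)) fun θ => ?_
  simpa using hu.2 (Set.mem_univ (f θ)) (Set.mem_univ (g θ)) hl0 (sub_nonneg.2 hl1) (by ring)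

theorem exists_isProbabilityMeasure_integral_eq_two_point {Θ : Type*} [MeasurableSpace Θ]
    [MeasurableSingletonClass Θ] (a b : Θ) {p : ℝ} (hp0 : 0 ≤ p) (hp1 : p ≤ 1) :
    ∃ μ : Measure Θ, IsProbabilityMeasure μ ∧
      ∀ f : Θ → ℝ, ∫ θ, f θ ∂μ = p * f a + (1 - p) * f b := by
  have hq : 0 ≤ 1 - p := sub_nonneg.2 hp1
  refine ⟨ENNReal.ofReal p • Measure.dirac a + ENNReal.ofReal (1 - p) • Measure.dirac b,
    ⟨?_⟩, fun f => ?_⟩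
  · simp [← ENNReal.ofReal_add hp0 hq]
  · have hint : ∀ (q : ℝ) (c : Θ), Integrable f (ENNReal.ofReal q • Measure.dirac c) :=
      fun q c => (integrable_dirac (by simp)).smul_measure ENNReal.ofReal_ne_top
    rw [integral_add_measure (hint p a) (hint (1 - p) b), integral_smul_measure,
      integral_smul_measure, integral_dirac, integral_dirac, ENNReal.toReal_ofReal hp0,
      ENNReal.toReal_ofReal hq, smul_eq_mul, smul_eq_mul]

theorem strictConcaveOn_neg_exp_neg :
    StrictConcaveOn ℝ Set.univ fun x : ℝ => -Real.exp (-x) := by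
  refine ⟨convex_univ, fun x _ y _ hxy s t hs ht hst => ?_⟩
  have h := strictConvexOn_exp.2 (Set.mem_univ (-x)) (Set.mem_univ (-y))
    (neg_injective.ne hxy) hs ht hst
  simp only [smul_eq_mul] at h ⊢
  rw [show -(s * x + t * y) = s * -x + t * -y by ring]
  linarith

theorem strictMono_neg_exp_neg : StrictMono fun x : ℝ => -Real.exp (-x) := fun _ _ hxy =>
  neg_lt_neg (Real.exp_lt_exp.2 (neg_lt_neg hxy))

/-- If a strictly concave agent is indifferent between `0` and a nondegenerate two-point lottery,
then she strictly prefers `0` to any scaling-up of that lottery. -/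
theorem StrictConcaveOn.two_point_scale_lt {u : ℝ → ℝ} (hu : StrictConcaveOn ℝ Set.univ u)
    {x y p l : ℝ} (hx : x ≠ 0) (hy : y ≠ 0) (hp0 : 0 ≤ p) (hp1 : p ≤ 1) (hl : 1 < l)
    (h : p * u x + (1 - p) * u y = u 0) : p * u (l * x) + (1 - p) * u (l * y) < u 0 := by
  have hl0 : 0 < l := by linarith
  have key : ∀ z : ℝ, z ≠ 0 → u (l * z) - u 0 < l * (u z - u 0) := fun z hz => by
    have hc := hu.2 (Set.mem_univ (l * z)) (Set.mem_univ 0) (mul_ne_zero hl0.ne' hz)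
      (inv_pos.2 hl0) (sub_pos.2 (inv_lt_one_of_one_lt₀ hl)) (by ring)
    simp only [smul_eq_mul, mul_zero, add_zero, inv_mul_cancel_left₀ hl0.ne'] at hc
    have := mul_lt_mul_of_pos_left hc hl0
    rw [mul_add, mul_inv_cancel_left₀ hl0.ne', ← mul_assoc, mul_sub, mul_one,
      mul_inv_cancel₀ hl0.ne'] at this
    linarith
  rcases hp0.eq_or_lt with rfl | hp
  · have := key y hy
    simp only [zero_mul, zero_add, sub_zero, one_mul] at h ⊢
    rw [h] at this
    linarith
  · have h1 := mul_lt_mul_of_pos_left (key x hx) hp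
    have h2 := mul_le_mul_of_nonneg_left (key y hy).le (sub_nonneg.2 hp1)
    have h3 : l * (p * u x + (1 - p) * u y) = l * u 0 := by rw [h]
    linarith

theorem MustBeAcceptable.two_point {Θ : Type*} [TopologicalSpace Θ] [MeasurableSpace Θ]
    [MeasurableSingletonClass Θ] {v γ γhat : C(Θ, ℝ)} (h : MustBeAcceptable v γ γhat) (a b : Θ)
    {p : ℝ} (hp0 : 0 ≤ p) (hp1 : p ≤ 1)
    (he : p * (γ a - v a) + (1 - p) * (γ b - v b) = 0) :
    p * (γhat a - v a) + (1 - p) * (γhat b - v b) = 0 := by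
  obtain ⟨μ, hμ, hint⟩ := exists_isProbabilityMeasure_integral_eq_two_point a b hp0 hp1
  obtain ⟨⟨hb, -⟩, hs, -⟩ := h id strictMono_id (concaveOn_id convex_univ) continuous_id μ hμ
  simp only [hint, id] at hb hs
  have := hb (by linarith)
  have := hs (by linarith)
  linarith

theorem MustBeAcceptable.pos_of_pos {Θ : Type*} [TopologicalSpace Θ] [MeasurableSpace Θ]
    [MeasurableSingletonClass Θ] {v γ γhat : C(Θ, ℝ)} (h : MustBeAcceptable v γ γhat) {a : Θ}
    (ha : v a < γ a) : v a < γhat a := by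
  have hs := (h id strictMono_id (concaveOn_id convex_univ) continuous_id (Measure.dirac a)
    inferInstance).2.2
  simpa using hs (by simpa using ha)

/-- A net transfer that must be acceptable is a positive multiple of the status quo net transfer. -/
theorem MustBeAcceptable.exists_eq_mul {Θ : Type*} [TopologicalSpace Θ] [MeasurableSpace Θ]
    [MeasurableSingletonClass Θ] {v γ γhat : C(Θ, ℝ)} (h : MustBeAcceptable v γ γhat) {a b : Θ}
    (ha : γ a < v a) (hb : v b < γ b) :
    ∃ l : ℝ, 0 < l ∧ ∀ θ, γhat θ - v θ = l * (γ θ - v θ) := by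
  have hcross : ∀ x y : Θ, γ x < v x → v y < γ y →
      (γ y - v y) * (γhat x - v x) = (γ x - v x) * (γhat y - v y) := fun x y hx hy => by
    have hd : 0 < (γ y - v y) - (γ x - v x) := by linarith
    have hp : 1 - (γ y - v y) / ((γ y - v y) - (γ x - v x)) =
        -(γ x - v x) / ((γ y - v y) - (γ x - v x)) := by field_simp; ring
    have := h.two_point x y (p := (γ y - v y) / ((γ y - v y) - (γ x - v x)))
      (div_nonneg (by linarith) hd.le) ((div_le_one hd).2 (by linarith))
      (by rw [hp]; field_simp; ring)
    rw [hp] at this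
    field_simp at this
    linarith
  have hb' : 0 < γ b - v b := sub_pos.2 hb
  have ha' : γ a - v a < 0 := sub_neg.2 ha
  have hlb : (γhat b - v b) / (γ b - v b) * (γ b - v b) = γhat b - v b := div_mul_cancel₀ _ hb'.ne'
  refine ⟨(γhat b - v b) / (γ b - v b), div_pos (sub_pos.2 (h.pos_of_pos hb)) hb', fun θ => ?_⟩
  have hneg : ∀ x, γ x < v x →
      γhat x - v x = (γhat b - v b) / (γ b - v b) * (γ x - v x) := fun x hx => by
    have := hcross x b hx hb
    field_simp
    linarith
  rcases lt_trichotomy (γ θ) (v θ) with hθ | hθ | hθ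
  · exact hneg θ hθ
  · have := h.two_point θ θ zero_le_one le_rfl (by simp [hθ])
    simp only [sub_self, zero_mul, one_mul, add_zero] at this
    rw [this, hθ, sub_self, mul_zero]
  · have hc := hcross a θ ha hθ
    rw [hneg a ha] at hc
    refine mul_left_cancel₀ ha'.ne ?_
    rw [← hc]
    ring

theorem MustBeAcceptable.le_one {Θ : Type*} [TopologicalSpace Θ] [MeasurableSpace Θ]
    [MeasurableSingletonClass Θ] {v γ γhat : C(Θ, ℝ)} (h : MustBeAcceptable v γ γhat) {a b : Θ}
    (ha : γ a < v a) (hb : v b < γ b) {l : ℝ}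
    (hl : ∀ θ, γhat θ - v θ = l * (γ θ - v θ)) : l ≤ 1 := by
  by_contra! hl1
  let u : ℝ → ℝ := fun x => -Real.exp (-x)
  have hu : StrictMono u := strictMono_neg_exp_neg
  have huc : StrictConcaveOn ℝ Set.univ u := strictConcaveOn_neg_exp_neg
  have hua : u 0 < u (v a - γ a) := hu (sub_pos.2 ha)
  have hub : u (v b - γ b) < u 0 := hu (sub_neg.2 hb)
  have hd : 0 < u (v a - γ a) - u (v b - γ b) := by linarith
  set p := (u 0 - u (v b - γ b)) / (u (v a - γ a) - u (v b - γ b))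
  have hp0 : 0 ≤ p := div_nonneg (by linarith) hd.le
  have hp1 : p ≤ 1 := (div_le_one hd).2 (by linarith)
  have hmix : p * u (v a - γ a) + (1 - p) * u (v b - γ b) = u 0 := by
    have : p * (u (v a - γ a) - u (v b - γ b)) = u 0 - u (v b - γ b) :=
      div_mul_cancel₀ _ hd.ne'
    linarith
  obtain ⟨μ, hμ, hint⟩ := exists_isProbabilityMeasure_integral_eq_two_point a b hp0 hp1
  have hbuy := (h u hu huc.concaveOn (by fun_prop) μ hμ).1.1
  rw [hint, hint] at hbuy
  have hlt := huc.two_point_scale_lt (sub_pos.2 ha).ne' (sub_neg.2 hb).ne hp0 hp1 hl1 hmix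
  rw [show l * (v a - γ a) = v a - γhat a by linarith [hl a],
    show l * (v b - γ b) = v b - γhat b by linarith [hl b]] at hlt
  exact (hbuy hmix.ge).not_gt hlt

/-- Remark (bilateral trade): a new agreement `γhat` must be acceptable iff it
is a nontrivial convex combination of the status quo transfer `γ` and the
asset value `v`. -/
theorem trade_must_accept_iff {Θ : Type*} [TopologicalSpace Θ] [CompactSpace Θ]
    [TopologicalSpace.MetrizableSpace Θ] [MeasurableSpace Θ] [BorelSpace Θ]
    (v γ γhat : C(Θ, ℝ))
    (h1 : ∃ θ, v θ > γ θ) (h2 : ∃ θ, γ θ > v θ) :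
    MustBeAcceptable v γ γhat ↔
      ∃ l ∈ Set.Ioc (0 : ℝ) 1, ∀ θ, γhat θ = l * γ θ + (1 - l) * v θ := by
  obtain ⟨a, ha⟩ := h1
  obtain ⟨b, hb⟩ := h2
  constructor
  · intro h
    obtain ⟨l, hl0, hl⟩ := h.exists_eq_mul ha hb
    exact ⟨l, ⟨hl0, h.le_one ha hb hl⟩, fun θ => by linarith [hl θ]⟩
  · rintro ⟨l, ⟨hl0, hl1⟩, hl⟩ u - hu huc μ hμ
    have hbuy := le_integral_comp_convexCombination (μ := μ) hu huc
      (f := fun θ => v θ - γ θ) (g := fun _ => 0) (by fun_prop) (by fun_prop) hl0.le hl1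
    have hsell := le_integral_comp_convexCombination (μ := μ) hu huc
      γ.continuous v.continuous hl0.le hl1
    have hnet : ∀ θ, l * (v θ - γ θ) + (1 - l) * 0 = v θ - γhat θ := fun θ => by
      rw [hl θ]; ring
    simp only [hnet, integral_const, probReal_univ, one_smul] at hbuy
    simp only [← hl] at hsell
    refine ⟨⟨fun h => ?_, fun h => ?_⟩, fun h => ?_, fun h => ?_⟩
    · linarith [mul_le_mul_of_nonneg_left h hl0.le]
    · linarith [mul_lt_mul_of_pos_left h hl0]
    · linarith [mul_le_mul_of_nonneg_left h hl0.le]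
    · linarith [mul_lt_mul_of_pos_left h hl0]
end
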